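/- For every cutoff χ as in the context there exists N such that for every n ∈ 16ℕ with n ≥ N the following holds: ‖u_{0,n}‖_{B^1_{∞,1}(𝕋)} ≤ 1/(log log n); and if u : [0, 1/log n] × 𝕋 → ℝ is a smooth solution of the periodic Camassa–Holm equation with u(0,·) = u_{0,n}, then there exists t₀ ∈ (0, 1/log n] such that ‖u(t₀,·)‖_{B^1_{∞,1}(𝕋)} ≥ log log n. -/

import Mathlib

open MeasureTheory Filter Function
open scoped ENNReal NNReal

noncomputable section

/-- The Fourier coefficient `û(ξ) = ∫_{-π}^{π} e^{-i x ξ} u(x) dx` of a `2π`-periodic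
function on the torus. -/
def fCoeff (u : ℝ → ℂ) (ξ : ℤ) : ℂ :=
  ∫ x in (-Real.pi)..Real.pi, Complex.exp (-Complex.I * x * ξ) * u x

/-- A Littlewood–Paley cutoff function: smooth, even, `0 ≤ χ ≤ 1`, `χ = 1` on `[-3/4,3/4]`,
`supp χ ⊆ (-4/3, 4/3)`, nonincreasing on `[0,∞)`. -/
structure LPCutoff where
  χ : ℝ → ℝ
  smooth : ContDiff ℝ (⊤ : ℕ∞) χ
  even : ∀ x, χ (-x) = χ x
  nonneg : ∀ x, 0 ≤ χ x
  le_one : ∀ x, χ x ≤ 1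
  eq_one : ∀ x ∈ Set.Icc (-(3/4) : ℝ) (3/4 : ℝ), χ x = 1
  supp : ∀ x, χ x ≠ 0 → x ∈ Set.Ioo (-(4/3) : ℝ) (4/3 : ℝ)
  decay : AntitoneOn χ (Set.Ici 0)

/-- `φ(ξ) = χ(ξ/2) - χ(ξ)`. -/
def LPCutoff.phi (c : LPCutoff) (x : ℝ) : ℝ := c.χ (x / 2) - c.χ x

/-- The dyadic block `Δ_j u` (for `j ≥ -1`). -/
def LPblock (c : LPCutoff) (j : ℤ) (u : ℝ → ℂ) (x : ℝ) : ℂ :=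
  if j = -1 then
    (1 / (2 * Real.pi)) * ∑' ξ : ℤ, (c.χ ξ : ℂ) * fCoeff u ξ * Complex.exp (Complex.I * x * ξ)
  else
    (1 / (2 * Real.pi)) *
      ∑' ξ : ℤ, (c.phi ((2:ℝ) ^ (-j) * ξ) : ℂ) * fCoeff u ξ * Complex.exp (Complex.I * x * ξ)

/-- The low-frequency cut-off `S_j u`. -/
def LPlow (c : LPCutoff) (j : ℤ) (u : ℝ → ℂ) (x : ℝ) : ℂ :=
  (1 / (2 * Real.pi)) *
    ∑' ξ : ℤ, (c.χ ((2:ℝ) ^ (-j) * ξ) : ℂ) * fCoeff u ξ * Complex.exp (Complex.I * x * ξ)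

/-- The `L^∞(𝕋)` (sup) norm, with values in `ℝ≥0∞`. -/
def supNormE {E : Type*} [NormedAddCommGroup E] (f : ℝ → E) : ℝ≥0∞ :=
  ⨆ x : ℝ, (‖f x‖₊ : ℝ≥0∞)

/-- View a real-valued function as a complex-valued one. -/
def toC (f : ℝ → ℝ) : ℝ → ℂ := fun x => (f x : ℂ)

/-- The `2π`-periodic square wave: `1/2` on `(0,π)`, `-1/2` on `(-π,0)`, `0` on `{-π,0,π}`. -/
def hFun (x : ℝ) : ℝ :=
  let y := x - 2 * Real.pi * ⌊(x + Real.pi) / (2 * Real.pi)⌋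
  if y = 0 ∨ y = -Real.pi then 0 else if 0 < y then 1/2 else -1/2

/-- The low-frequency part `f_n = S_{n/2} h` (real-valued). -/
def fLow (c : LPCutoff) (n : ℕ) : ℝ → ℝ := fun x => (LPlow c ((n : ℤ) / 2) (toC hFun) x).re

/-- The initial data `u_{0,n}` for the periodic Camassa–Holm equation. -/
def u0CH (c : LPCutoff) (n : ℕ) : ℝ → ℝ := fun x =>
  (2:ℝ) ^ (-(n:ℤ)) * (n:ℝ) ^ (-(2:ℝ)/5) * Real.log n * Real.cos ((2:ℝ) ^ (n:ℕ) * x) *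
    (1 + (n:ℝ) ^ (-(1:ℝ)/5) * fLow c n x)

/-- The `B^1_{∞,1}(𝕋)` norm `Σ_{j ≥ -1} 2^j ‖Δ_j u‖_{L^∞}`, with values in `ℝ≥0∞`. -/
def besov1E (c : LPCutoff) (u : ℝ → ℂ) : ℝ≥0∞ :=
  ∑' k : ℕ, (2:ℝ≥0∞) ^ ((k:ℤ) - 1) * supNormE (LPblock c ((k:ℤ) - 1) u)

/-- `u` is a smooth, spatially `2π`-periodic solution of the periodic Camassa–Holm equation
`∂_t u - ∂_t ∂_x² u + 3 u ∂_x u = 2 ∂_x u ∂_x² u + u ∂_x³ u` on `[0,T] × 𝕋`. -/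
def IsCHSolution (T : ℝ) (u : ℝ → ℝ → ℝ) : Prop :=
  ContDiff ℝ (⊤ : ℕ∞) (Function.uncurry u) ∧
  (∀ t, Function.Periodic (u t) (2 * Real.pi)) ∧
  ∀ t ∈ Set.Icc (0:ℝ) T, ∀ x : ℝ,
    deriv (fun s => u s x) t - deriv (fun s => deriv (deriv (u s)) x) t
        + 3 * u t x * deriv (u t) x
      = 2 * deriv (u t) x * deriv (deriv (u t)) x + u t x * deriv (deriv (deriv (u t))) x


/-- trigonometric polynomial -/
def trigP (s : Finset ℤ) (a : ℤ → ℂ) (x : ℝ) : ℂ :=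
  ∑ ξ ∈ s, a ξ * Complex.exp (Complex.I * x * ξ)

lemma tri_hasSum {D ξ : ℝ} (hD : 0 < D) (h : |ξ| ≤ D) :
    HasSum (fun n : ℕ => (1 / (n:ℝ)^2 * (1 - (-1)^n)) *
      Real.cos (Real.pi * n / 2 + ξ * (Real.pi * n / (2 * D)))) (-(Real.pi^2 * ξ / (4 * D))) := by
  have h1 := abs_le.1 h
  have hd : |ξ / (4 * D)| ≤ 1/4 := by
    rw [abs_div, abs_of_pos (by positivity : 0 < 4 * D), div_le_iff₀ (by positivity)]
    linarith
  have hd' := abs_le.1 hd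
  set y : ℝ := 1/4 + ξ / (4*D) with hy
  have e1 := hasSum_one_div_nat_pow_mul_cos (k := 1) one_ne_zero (x := y)
    ⟨by linarith, by linarith⟩
  have e2 := hasSum_one_div_nat_pow_mul_cos (k := 1) one_ne_zero (x := y + 1/2)
    ⟨by linarith, by linarith⟩
  have e3 := e1.sub e2
  have hB : ∀ z : ℝ, (Polynomial.map (algebraMap ℚ ℝ) (Polynomial.bernoulli (2 * 1))).eval z
      = z^2 - z + 1/6 := by
    intro z
    rw [show 2 * 1 = 2 from rfl, Polynomial.bernoulli_def]
    simp [Finset.sum_range_succ, bernoulli_one, bernoulli_two]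
    ring
  rw [hB, hB] at e3
  convert! e3 using 1
  · funext n
    have : Real.cos (2 * Real.pi * n * (y + 1/2)) = (-1)^n * Real.cos (2 * Real.pi * n * y) := by
      have : 2 * Real.pi * n * (y + 1/2) = 2 * Real.pi * n * y + n * Real.pi := by ring
      rw [this, Real.cos_add_nat_mul_pi]
    rw [this]
    have : Real.pi * n / 2 + ξ * (Real.pi * n / (2 * D)) = 2 * Real.pi * n * y := by
      rw [hy]; field_simp; ring
    rw [this]
    ring
  · rw [hy]; simp; field_simp; ring

lemma ch_bernstein (s : Finset ℤ) (a : ℤ → ℂ) {D M : ℝ} (hD : 0 < D)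
    (hs : ∀ ξ ∈ s, |(ξ:ℝ)| ≤ D) (hM : ∀ x, ‖trigP s a x‖ ≤ M) (x : ℝ) :
    ‖trigP s (fun ξ => Complex.I * ξ * a ξ) x‖ ≤ 4/3 * D * M := by
  have hπ := Real.pi_pos
  have key : HasSum (fun n : ℕ => (-(Complex.I * (4 * D / Real.pi^2 : ℝ)) *
      ((1 / (n:ℝ)^2 * (1 - (-1)^n) : ℝ) : ℂ) / 2) *
      (Complex.exp (Complex.I * (Real.pi * n / 2 : ℝ)) * trigP s a (x + Real.pi * n / (2 * D))
      + Complex.exp (-(Complex.I * (Real.pi * n / 2 : ℝ))) * trigP s a (x - Real.pi * n / (2 * D))))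
      (trigP s (fun ξ => Complex.I * ξ * a ξ) x) := by
    unfold trigP
    have : ∀ ξ ∈ s, HasSum (fun n : ℕ => (-(Complex.I * (4 * D / Real.pi^2 : ℝ)) * a ξ *
        Complex.exp (Complex.I * x * ξ)) * (((1 / (n:ℝ)^2 * (1 - (-1)^n)) *
      Real.cos (Real.pi * n / 2 + ξ * (Real.pi * n / (2 * D))) : ℝ) : ℂ))
        (Complex.I * ξ * a ξ * Complex.exp (Complex.I * x * ξ)) := by
      intro ξ hξ
      have := (Complex.hasSum_ofReal.2 (tri_hasSum hD (hs ξ hξ))).mul_left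
        (-(Complex.I * (4 * D / Real.pi^2 : ℝ)) * a ξ * Complex.exp (Complex.I * x * ξ))
      convert! this using 1
      have : (D:ℂ) ≠ 0 := by exact_mod_cast hD.ne'
      have : (Real.pi:ℂ) ≠ 0 := by exact_mod_cast hπ.ne'
      push_cast
      field_simp
    have h2 := hasSum_sum this
    convert! h2 using 1
    funext n
    rw [Finset.mul_sum, Finset.mul_sum, ← Finset.sum_add_distrib, Finset.mul_sum]
    refine Finset.sum_congr rfl fun ξ _ => ?_
    have e1 : Complex.exp (Complex.I * ((x + Real.pi * n / (2 * D) : ℝ):ℂ) * ξ) =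
        Complex.exp (Complex.I * x * ξ) * Complex.exp (Complex.I * (ξ * (Real.pi * n / (2 * D)) : ℝ)) := by
      rw [← Complex.exp_add]; congr 1; push_cast; ring
    have e2 : Complex.exp (Complex.I * ((x - Real.pi * n / (2 * D) : ℝ):ℂ) * ξ) =
        Complex.exp (Complex.I * x * ξ) * Complex.exp (-(Complex.I * (ξ * (Real.pi * n / (2 * D)) : ℝ))) := by
      rw [← Complex.exp_add]; congr 1; push_cast; ring
    have e3 : ((Real.cos (Real.pi * n / 2 + ξ * (Real.pi * n / (2 * D))) : ℝ) : ℂ) =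
        (Complex.exp (Complex.I * (Real.pi * n / 2 : ℝ)) * Complex.exp (Complex.I * (ξ * (Real.pi * n / (2 * D)) : ℝ))
        + Complex.exp (-(Complex.I * (Real.pi * n / 2 : ℝ))) * Complex.exp (-(Complex.I * (ξ * (Real.pi * n / (2 * D)) : ℝ)))) / 2 := by
      rw [← Complex.exp_add, ← Complex.exp_add, Complex.ofReal_cos, Complex.cos]
      congr 2
      · congr 1; push_cast; ring
      · congr 1; push_cast; ring
    rw [e1, e2]
    rw [Complex.ofReal_mul _ (Real.cos _), e3]
    ring
  rw [← key.tsum_eq]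
  have hz : HasSum (fun n : ℕ => (4 * D / Real.pi^2 * 2 * M) * (1 / (n:ℝ)^2))
      ((4 * D / Real.pi^2 * 2 * M) * (Real.pi^2/6)) := hasSum_zeta_two.mul_left _
  have : (4 * D / Real.pi^2 * 2 * M) * (Real.pi^2/6) = 4/3 * D * M := by field_simp; ring
  rw [← this]
  refine tsum_of_norm_bounded hz fun n => ?_
  have hM0 : 0 ≤ M := (norm_nonneg _).trans (hM 0)
  have n1 : ∀ r : ℝ, ‖Complex.exp (Complex.I * r)‖ = 1 := fun r => by
    rw [mul_comm]; exact Complex.norm_exp_ofReal_mul_I r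
  have n2 : ∀ r : ℝ, ‖Complex.exp (-(Complex.I * r))‖ = 1 := fun r => by
    have := n1 (-r); simpa using this
  have n3 : ‖Complex.exp (Complex.I * (Real.pi * n / 2 : ℝ)) * trigP s a (x + Real.pi * n / (2 * D))
      + Complex.exp (-(Complex.I * (Real.pi * n / 2 : ℝ))) * trigP s a (x - Real.pi * n / (2 * D))‖ ≤ 2 * M := by
    refine (norm_add_le _ _).trans ?_
    rw [norm_mul, norm_mul, n1, n2]
    have := hM (x + Real.pi * n / (2 * D)); have := hM (x - Real.pi * n / (2 * D)); linarith
  rw [norm_mul]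
  have n4 : ‖-(Complex.I * (4 * D / Real.pi^2 : ℝ)) *
      ((1 / (n:ℝ)^2 * (1 - (-1)^n) : ℝ) : ℂ) / 2‖ ≤ 4 * D / Real.pi^2 * (1/(n:ℝ)^2) := by
    rw [norm_div, norm_mul, norm_neg, norm_mul, Complex.norm_I, one_mul, Complex.norm_real,
      Complex.norm_real, Real.norm_of_nonneg (by positivity)]
    have : ‖(1 / (n:ℝ)^2 * (1 - (-1)^n) : ℝ)‖ ≤ 1 / (n:ℝ)^2 * 2 := by
      rw [norm_mul, Real.norm_of_nonneg (by positivity)]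
      refine mul_le_mul_of_nonneg_left ?_ (by positivity)
      rcases neg_one_pow_eq_or ℝ n with h | h <;> rw [h] <;> norm_num
    have h0 : 0 ≤ 4 * D / Real.pi^2 := by positivity
    have := mul_le_mul_of_nonneg_left this h0
    simp only [Complex.norm_ofNat]
    linarith
  calc _ ≤ (4 * D / Real.pi^2 * (1/(n:ℝ)^2)) * (2 * M) :=
        mul_le_mul n4 n3 (norm_nonneg _) (by positivity)
    _ = _ := by ring

lemma trigP_hasDerivAt (s : Finset ℤ) (a : ℤ → ℂ) (x : ℝ) :
    HasDerivAt (trigP s a) (trigP s (fun ξ => Complex.I * ξ * a ξ) x) x := by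
  unfold trigP
  apply HasDerivAt.fun_sum
  intro ξ _
  have h : HasDerivAt (fun x : ℝ => Complex.I * (x:ℂ) * ξ) (Complex.I * ξ) x := by
    have := ((Complex.ofRealCLM.hasDerivAt (x := x)).const_mul Complex.I).mul_const (ξ:ℂ)
    simpa using this
  have := (h.cexp).const_mul (a ξ)
  convert! this using 1
  ring

/-- Lipschitz bound -/
lemma trigP_lip (s : Finset ℤ) (a : ℤ → ℂ) {D M : ℝ} (hD : 0 < D)
    (hs : ∀ ξ ∈ s, |(ξ:ℝ)| ≤ D) (hM : ∀ x, ‖trigP s a x‖ ≤ M) (x y : ℝ) :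
    ‖trigP s a y - trigP s a x‖ ≤ 4/3 * D * M * |y - x| := by
  have := Convex.norm_image_sub_le_of_norm_hasDerivWithin_le (s := Set.univ) (x := x) (y := y)
    (fun z _ => (trigP_hasDerivAt s a z).hasDerivWithinAt)
    (fun z _ => ch_bernstein s a hD hs hM z) convex_univ (Set.mem_univ _) (Set.mem_univ _)
  simpa using this

/-- The four point functional -/
def fourPt {E : Type*} [AddCommGroup E] (v : ℝ → E) (q h : ℝ) : E :=
  (v (q + 2 * h) - v (q + h)) - (v (q - h) - v (q - 2 * h))

lemma fourPt_triv (v : ℝ → ℂ) (q h M : ℝ) (hM : ∀ x, ‖v x‖ ≤ M) : ‖fourPt v q h‖ ≤ 4 * M := by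
  unfold fourPt
  have h1 := norm_sub_le (v (q + 2 * h) - v (q + h)) (v (q - h) - v (q - 2 * h))
  have h2 := norm_sub_le (v (q + 2 * h)) (v (q + h))
  have h3 := norm_sub_le (v (q - h)) (v (q - 2 * h))
  have := hM (q+2*h); have := hM (q+h); have := hM (q-h); have := hM (q-2*h)
  linarith

lemma fourPt_smooth (s : Finset ℤ) (a : ℤ → ℂ) {D M : ℝ} (hD : 0 < D)
    (hs : ∀ ξ ∈ s, |(ξ:ℝ)| ≤ D) (hM : ∀ x, ‖trigP s a x‖ ≤ M) (q h : ℝ) (hh : 0 ≤ h) :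
    ‖fourPt (trigP s a) q h‖ ≤ 3 * (4/3 * D)^2 * M * h^2 := by
  have hM0 : 0 ≤ M := (norm_nonneg _).trans (hM 0)
  set F : ℝ → ℂ := fun t => trigP s a (q + h + t) - trigP s a (q - 2 * h + t) with hF
  have hd : ∀ t, HasDerivAt F (trigP s (fun ξ => Complex.I * ξ * a ξ) (q + h + t)
      - trigP s (fun ξ => Complex.I * ξ * a ξ) (q - 2 * h + t)) t := fun t =>
    ((trigP_hasDerivAt s a (q+h+t)).comp_const_add (q+h) t).sub
      ((trigP_hasDerivAt s a (q-2*h+t)).comp_const_add (q-2*h) t)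
  have hb : ∀ t, ‖trigP s (fun ξ => Complex.I * ξ * a ξ) (q + h + t)
      - trigP s (fun ξ => Complex.I * ξ * a ξ) (q - 2 * h + t)‖ ≤ 3 * (4/3 * D)^2 * M * h := by
    intro t
    have := trigP_lip s (fun ξ => Complex.I * ξ * a ξ) hD hs (ch_bernstein s a hD hs hM)
      (q - 2 * h + t) (q + h + t)
    refine this.trans (le_of_eq ?_)
    have : q + h + t - (q - 2 * h + t) = 3 * h := by ring
    rw [this, abs_of_nonneg (by positivity)]; ring
  have := Convex.norm_image_sub_le_of_norm_hasDerivWithin_le (s := Set.univ) (x := 0) (y := h)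
    (fun z _ => (hd z).hasDerivWithinAt)
    (fun z _ => hb z) convex_univ (Set.mem_univ _) (Set.mem_univ _)
  have e : F h - F 0 = fourPt (trigP s a) q h := by
    simp only [hF, fourPt]
    have e1 : q + h + h = q + 2 * h := by ring
    have e2 : q - 2 * h + h = q - h := by ring
    rw [e1, e2, add_zero, add_zero]; abel
  rw [e] at this
  refine this.trans (le_of_eq ?_)
  rw [sub_zero, Real.norm_of_nonneg hh]; ring


lemma LPCutoff.zero_of_ge (c : LPCutoff) {x : ℝ} (h : 4/3 ≤ |x|) : c.χ x = 0 := by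
  by_contra h0
  have := c.supp x h0
  have : |x| < 4/3 := abs_lt.2 this
  linarith

/-- multiplier of the `k`-th block (`k = j + 1`) -/
def bMult (c : LPCutoff) (k : ℕ) (ξ : ℤ) : ℝ :=
  if k = 0 then c.χ ξ else c.phi ((2:ℝ) ^ (-((k:ℤ) - 1)) * ξ)

lemma LPblock_eq (c : LPCutoff) (k : ℕ) (u : ℝ → ℂ) (x : ℝ) :
    LPblock c ((k:ℤ) - 1) u x = (1 / (2 * Real.pi)) *
      ∑' ξ : ℤ, (bMult c k ξ : ℂ) * fCoeff u ξ * Complex.exp (Complex.I * x * ξ) := by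
  unfold LPblock bMult
  by_cases hk : k = 0
  · subst hk; simp
  · have : ¬ ((k:ℤ) - 1 = -1) := by omega
    simp only [this, hk, if_false]

lemma bMult_succ (c : LPCutoff) (k : ℕ) (ξ : ℤ) :
    bMult c (k+1) ξ = c.χ ((2:ℝ)^(-((k+1:ℕ):ℤ)) * ξ) - c.χ ((2:ℝ)^(-(k:ℤ)) * ξ) := by
  unfold bMult LPCutoff.phi
  simp only [Nat.succ_ne_zero, if_false]
  have e1 : -(((k+1:ℕ):ℤ) - 1) = -(k:ℤ) := by push_cast; ring
  have e2 : (2:ℝ)^(-((k+1:ℕ):ℤ)) = (2:ℝ)^(-(k:ℤ)) / 2 := by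
    rw [show -((k+1:ℕ):ℤ) = -(k:ℤ) - 1 by push_cast; ring, zpow_sub₀ (by norm_num)]
    norm_num
  rw [e1, e2]
  congr 2
  ring

lemma bMult_sum (c : LPCutoff) (K : ℕ) (ξ : ℤ) :
    ∑ k ∈ Finset.range (K+1), bMult c k ξ = c.χ ((2:ℝ)^(-(K:ℤ)) * ξ) := by
  induction K with
  | zero => simp [bMult]
  | succ K ih => rw [Finset.sum_range_succ, ih, bMult_succ]; ring

lemma bMult_zero_of (c : LPCutoff) (k : ℕ) (ξ : ℤ) (h : (2:ℝ)^(k+1) < |(ξ:ℝ)|) :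
    bMult c k ξ = 0 := by
  have key : ∀ j : ℕ, j ≤ k → c.χ ((2:ℝ)^(-(j:ℤ)) * ξ) = 0 := by
    intro j hj
    apply c.zero_of_ge
    rw [abs_mul, abs_of_pos (by positivity : (0:ℝ) < (2:ℝ)^(-(j:ℤ))), zpow_neg, zpow_natCast]
    rw [inv_mul_eq_div, le_div_iff₀ (by positivity)]
    have : (2:ℝ)^j ≤ 2^k := pow_le_pow_right₀ (by norm_num) hj
    rw [pow_succ] at h
    have : (0:ℝ) < 2^k := by positivity
    linarith
  cases k with
  | zero => have := key 0 le_rfl; simpa [bMult] using this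
  | succ k => rw [bMult_succ, key _ le_rfl, key k (by omega)]; ring

/-- the frequency window of the `k`-th block -/
def bWin (k : ℕ) : Finset ℤ := Finset.Icc (-(2^(k+1))) (2^(k+1))

lemma bWin_le (k : ℕ) : ∀ ξ ∈ bWin k, |(ξ:ℝ)| ≤ 2^(k+1) := by
  intro ξ h
  rw [bWin, Finset.mem_Icc] at h
  rw [abs_le]; constructor
  · exact_mod_cast h.1
  · exact_mod_cast h.2

lemma not_bWin {k : ℕ} {ξ : ℤ} (h : ξ ∉ bWin k) : (2:ℝ)^(k+1) < |(ξ:ℝ)| := by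
  by_contra h0
  apply h
  push Not at h0
  rw [abs_le] at h0
  rw [bWin, Finset.mem_Icc]
  constructor
  · exact_mod_cast h0.1
  · exact_mod_cast h0.2

lemma LPblock_trigP (c : LPCutoff) (k : ℕ) (u : ℝ → ℂ) :
    LPblock c ((k:ℤ) - 1) u =
      trigP (bWin k) (fun ξ => (1 / (2 * Real.pi)) * ((bMult c k ξ : ℂ) * fCoeff u ξ)) := by
  funext x
  rw [LPblock_eq, tsum_eq_sum (s := bWin k), Finset.mul_sum, trigP]
  · exact Finset.sum_congr rfl fun ξ _ => by ring
  · intro ξ h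
    rw [bMult_zero_of c k ξ (not_bWin h)]; simp

lemma geo_sum (k M : ℕ) : ∑ m ∈ Finset.range M, (if m < k then (2:ℝ)^m / 2^k else 2^k / 2^m) ≤ 3 := by
  have key : ∀ M, (M ≤ k → ∑ m ∈ Finset.range M, (if m < k then (2:ℝ)^m / 2^k else 2^k / 2^m) ≤ 2^M/2^k)
    ∧ (k ≤ M → ∑ m ∈ Finset.range M, (if m < k then (2:ℝ)^m / 2^k else 2^k / 2^m) ≤ 3 - 2 * 2^k/2^M) := by
    intro M
    have a1 : ∀ M, M ≤ k → ∑ m ∈ Finset.range M, (if m < k then (2:ℝ)^m / 2^k else 2^k / 2^m) ≤ 2^M/2^k := by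
      intro M
      induction M with
      | zero => intro _; simp
      | succ M ih =>
        intro h
        rw [Finset.sum_range_succ, if_pos (by omega)]
        have := ih (by omega)
        rw [pow_succ, mul_div_right_comm]; linarith
    refine ⟨a1 M, fun h => ?_⟩
    induction M, h using Nat.le_induction with
    | base =>
      have := a1 k le_rfl
      have e : (2:ℝ)^k/2^k = 1 := div_self (by positivity)
      rw [mul_div_assoc, e]; rw [e] at this; linarith
    | succ M h ih =>
      rw [Finset.sum_range_succ, if_neg (by omega)]
      have e : 2 * (2:ℝ)^k / 2^(M+1) = 2^k/2^M := by rw [pow_succ]; field_simp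
      have e' : 2 * (2:ℝ)^k/2^M = 2 * (2^k/2^M) := by ring
      rw [e]; rw [e'] at ih; linarith
  rcases le_total M k with h | h
  · have := (key M).1 h
    have : (2:ℝ)^M/2^k ≤ 1 := (div_le_one (by positivity)).2 (pow_le_pow_right₀ (by norm_num) h)
    linarith
  · have := (key M).2 h
    have : 0 ≤ 2 * (2:ℝ)^k/2^M := by positivity
    linarith

lemma fourPt_block (s : Finset ℤ) (a : ℤ → ℂ) (k m : ℕ) {M : ℝ}
    (hs : ∀ ξ ∈ s, |(ξ:ℝ)| ≤ 2^(k+1)) (hM : ∀ x, ‖trigP s a x‖ ≤ M) (q : ℝ) :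
    2^m * ‖fourPt (trigP s a) q (1/2^m)‖ ≤
      43 * (if m < k then (2:ℝ)^m / 2^k else 2^k / 2^m) * (2^k / 2 * M) := by
  have hM0 : 0 ≤ M := (norm_nonneg _).trans (hM 0)
  split_ifs with h
  · have := fourPt_triv (trigP s a) q (1/2^m) M hM
    calc _ ≤ 2^m * (4 * M) := by gcongr
      _ = 8 * ((2:ℝ)^m / 2^k) * (2^k / 2 * M) := by field_simp; ring
      _ ≤ _ := by gcongr; norm_num
  · have := fourPt_smooth s a (by positivity) hs hM q (1/2^m) (by positivity)
    calc _ ≤ 2^m * (3 * (4/3 * 2^(k+1))^2 * M * (1/2^m)^2) := by gcongr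
      _ = (128/3) * ((2:ℝ)^k / 2^m) * (2^k / 2 * M) := by rw [pow_succ]; field_simp; ring
      _ ≤ _ := by gcongr; norm_num

/-- Consequences of a Besov bound -/
lemma besov_cons (c : LPCutoff) (v : ℝ → ℂ) (L : ℝ) (hL : 0 ≤ L)
    (hconv : ∀ x, Tendsto (fun K => ∑ k ∈ Finset.range K, LPblock c ((k:ℤ)-1) v x) atTop (nhds (v x)))
    (hB : besov1E c v ≤ ENNReal.ofReal L) :
    (∀ x, ‖v x‖ ≤ 2 * L) ∧ (∀ x y, ‖v y - v x‖ ≤ 6 * L * |y - x|) ∧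
    (∀ M q, ∑ m ∈ Finset.range M, 2^m * ‖fourPt v q (1/2^m)‖ ≤ 129 * L) := by
  set T : ℕ → ℝ≥0∞ := fun k => (2:ℝ≥0∞) ^ ((k:ℤ) - 1) * supNormE (LPblock c ((k:ℤ) - 1) v) with hT
  have hsum : ∑' k, T k ≤ ENNReal.ofReal L := hB
  have hne : ∑' k, T k ≠ ⊤ := ne_top_of_le_ne_top ENNReal.ofReal_ne_top hsum
  have hTk : ∀ k, T k ≠ ⊤ := ENNReal.ne_top_of_tsum_ne_top hne
  set w : ℕ → ℝ := fun k => (T k).toReal with hw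
  have hw0 : ∀ k, 0 ≤ w k := fun k => ENNReal.toReal_nonneg
  have hws : Summable w := ENNReal.summable_toReal hne
  have hwL : ∑' k, w k ≤ L := by
    rw [← ENNReal.tsum_toReal_eq hTk]
    exact ENNReal.toReal_le_of_le_ofReal hL hsum
  have hz : ∀ k : ℕ, (2:ℝ≥0∞) ^ ((k:ℤ) - 1) = ENNReal.ofReal (2^k/2) := by
    intro k
    rw [ENNReal.zpow_sub (by norm_num) (by norm_num), ENNReal.ofReal_div_of_pos (by norm_num),
      ENNReal.ofReal_pow (by norm_num)]
    simp [div_eq_mul_inv]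
  have hsup : ∀ k : ℕ, supNormE (LPblock c ((k:ℤ) - 1) v) ≠ ⊤ := by
    intro k h
    apply hTk k
    rw [hT]; simp only
    rw [h, hz, ENNReal.mul_top]
    have : (0:ℝ) < 2^k/2 := by positivity
    simp [this]
  set β : ℕ → ℝ := fun k => (supNormE (LPblock c ((k:ℤ) - 1) v)).toReal with hβ
  have hwβ : ∀ k, w k = 2^k/2 * β k := by
    intro k
    simp only [hw, hT, hβ]
    rw [ENNReal.toReal_mul, hz, ENNReal.toReal_ofReal (by positivity)]
  have hblk : ∀ (k:ℕ) (x:ℝ), ‖LPblock c ((k:ℤ) - 1) v x‖ ≤ β k := by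
    intro k x
    have : (‖LPblock c ((k:ℤ) - 1) v x‖₊ : ℝ≥0∞) ≤ supNormE (LPblock c ((k:ℤ) - 1) v) :=
      le_iSup (fun x => (‖LPblock c ((k:ℤ) - 1) v x‖₊ : ℝ≥0∞)) x
    have := ENNReal.toReal_mono (hsup k) this
    simpa using this
  have hβ0 : ∀ k, 0 ≤ β k := fun k => ENNReal.toReal_nonneg
  have hβw : ∀ k, β k ≤ 2 * w k := by
    intro k
    rw [hwβ]
    have : (1:ℝ) ≤ 2^k := one_le_pow₀ (by norm_num)
    nlinarith [hβ0 k]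
  have hHS : ∀ x, HasSum (fun k : ℕ => LPblock c ((k:ℤ)-1) v x) (v x) := by
    intro x
    have : Summable (fun k : ℕ => LPblock c ((k:ℤ)-1) v x) :=
      Summable.of_norm_bounded (hws.mul_left 2) fun k => (hblk k x).trans (hβw k)
    have h2 := this.hasSum
    rwa [tendsto_nhds_unique h2.tendsto_sum_nat (hconv x)] at h2
  have hst : ∀ C : ℝ, 0 ≤ C → HasSum (fun k => C * w k) (C * ∑' k, w k) :=
    fun C _ => hws.hasSum.mul_left C
  refine ⟨fun x => ?_, fun x y => ?_, fun M q => ?_⟩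
  · rw [← (hHS x).tsum_eq]
    refine (tsum_of_norm_bounded (hst 2 (by norm_num)) fun k => (hblk k x).trans (hβw k)).trans ?_
    gcongr
  · rw [← ((hHS y).sub (hHS x)).tsum_eq]
    refine (tsum_of_norm_bounded (hst (6 * |y-x|) (by positivity)) fun k => ?_).trans ?_
    · have hb := hblk k
      rw [LPblock_trigP] at hb ⊢
      have := trigP_lip _ _ (by positivity) (bWin_le k) hb x y
      refine this.trans ?_
      rw [hwβ, pow_succ]
      have : 0 ≤ 2^k * β k * |y-x| := by have := hβ0 k; positivity
      nlinarith
    · have : 0 ≤ 6 * |y-x| := by positivity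
      nlinarith
  · have hF : ∀ m : ℕ, 2^m * ‖fourPt v q (1/2^m)‖ ≤
        ∑' k, 43 * (if m < k then (2:ℝ)^m / 2^k else 2^k / 2^m) * w k ∧
        Summable (fun k => 43 * (if m < k then (2:ℝ)^m / 2^k else 2^k / 2^m) * w k) := by
      intro m
      have hS : Summable (fun k => 43 * (if m < k then (2:ℝ)^m / 2^k else 2^k / 2^m) * w k) := by
        refine Summable.of_nonneg_of_le (fun k => ?_) (fun k => ?_) (hws.mul_left (43 * 1))
        · have := hw0 k
          split_ifs <;> positivity
        · refine mul_le_mul_of_nonneg_right (mul_le_mul_of_nonneg_left ?_ (by norm_num)) (hw0 k)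
          split_ifs with h
          · exact (div_le_one (by positivity)).2 (pow_le_pow_right₀ (by norm_num) h.le)
          · exact (div_le_one (by positivity)).2 (pow_le_pow_right₀ (by norm_num) (by omega))
      refine ⟨?_, hS⟩
      have h1 : HasSum (fun k : ℕ => (2^m : ℂ) * fourPt (LPblock c ((k:ℤ)-1) v) q (1/2^m))
          ((2^m : ℂ) * fourPt v q (1/2^m)) := by
        unfold fourPt
        exact (((hHS _).sub (hHS _)).sub ((hHS _).sub (hHS _))).mul_left _
      have e : 2^m * ‖fourPt v q (1/2^m)‖ = ‖(2^m : ℂ) * fourPt v q (1/2^m)‖ := by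
        rw [norm_mul]; simp
      rw [e, ← h1.tsum_eq]
      refine tsum_of_norm_bounded hS.hasSum fun k => ?_
      have hb := hblk k
      rw [LPblock_trigP] at hb ⊢
      have := fourPt_block _ _ k m (bWin_le k) hb q
      rw [hwβ]
      refine le_trans (le_of_eq ?_) this
      rw [norm_mul]; simp
    calc _ ≤ ∑ m ∈ Finset.range M, ∑' k, 43 * (if m < k then (2:ℝ)^m / 2^k else 2^k / 2^m) * w k :=
          Finset.sum_le_sum fun m _ => (hF m).1
      _ = ∑' k, ∑ m ∈ Finset.range M, 43 * (if m < k then (2:ℝ)^m / 2^k else 2^k / 2^m) * w k :=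
          (Summable.tsum_finsetSum fun m _ => (hF m).2).symm
      _ ≤ ∑' k, 129 * w k := by
          refine Summable.tsum_le_tsum (fun k => ?_) (summable_sum fun m _ => (hF m).2) (hws.mul_left _)
          rw [← Finset.sum_mul, ← Finset.mul_sum]
          have := geo_sum k M
          have := hw0 k
          nlinarith
      _ = 129 * ∑' k, w k := tsum_mul_left
      _ ≤ _ := by gcongr


lemma exp_hasDerivAt (ξ : ℤ) (x : ℝ) : HasDerivAt (fun x : ℝ => Complex.exp (-Complex.I * x * ξ))
    ((-Complex.I * ξ) * Complex.exp (-Complex.I * x * ξ)) x := by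
  have h : HasDerivAt (fun x : ℝ => -Complex.I * (x:ℂ) * ξ) (-Complex.I * ξ) x := by
    have := ((Complex.ofRealCLM.hasDerivAt (x := x)).const_mul (-Complex.I)).mul_const (ξ:ℂ)
    simpa using this
  have := h.cexp
  convert! this using 1
  ring

lemma exp_pi_eq (ξ : ℤ) : Complex.exp (-Complex.I * (Real.pi:ℝ) * ξ) =
    Complex.exp (-Complex.I * ((-Real.pi:ℝ):ℂ) * ξ) := by
  rw [Complex.exp_eq_exp_iff_exists_int]
  refine ⟨-ξ, ?_⟩
  push_cast; ring

lemma fCoeff_deriv (v v' : ℝ → ℂ) (hd : ∀ x, HasDerivAt v (v' x) x) (hc : Continuous v')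
    (hp : v Real.pi = v (-Real.pi)) (ξ : ℤ) : fCoeff v' ξ = Complex.I * ξ * fCoeff v ξ := by
  unfold fCoeff
  have hcv : Continuous v := continuous_iff_continuousAt.2 fun x => (hd x).continuousAt
  rw [intervalIntegral.integral_mul_deriv_eq_deriv_mul (fun x _ => exp_hasDerivAt ξ x)
    (fun x _ => hd x) (by apply Continuous.intervalIntegrable; fun_prop) (hc.intervalIntegrable _ _)]
  rw [exp_pi_eq, hp, sub_self, zero_sub, ← intervalIntegral.integral_const_mul,
    ← intervalIntegral.integral_neg]
  congr 1
  funext x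
  ring

lemma fCoeff_norm_le (v : ℝ → ℂ) (C : ℝ) (h : ∀ x, ‖v x‖ ≤ C) (ξ : ℤ) :
    ‖fCoeff v ξ‖ ≤ C * (2 * Real.pi) := by
  unfold fCoeff
  have := intervalIntegral.norm_integral_le_of_norm_le_const (a := -Real.pi) (b := Real.pi) (C := C)
    (f := fun x : ℝ => Complex.exp (-Complex.I * x * ξ) * v x) (fun x _ => by
      rw [norm_mul]
      have : ‖Complex.exp (-Complex.I * x * ξ)‖ = 1 := by
        have := Complex.norm_exp_ofReal_mul_I (-x * ξ)
        rw [← this]; congr 2; push_cast; ring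
      rw [this, one_mul]; exact h x)
  refine this.trans (le_of_eq ?_)
  rw [abs_of_nonneg (by linarith [Real.pi_pos])]; ring

lemma summable_fCoeff (v v' v'' : ℝ → ℂ) (hd : ∀ x, HasDerivAt v (v' x) x)
    (hd' : ∀ x, HasDerivAt v' (v'' x) x) (hc : Continuous v'')
    (hp : v Real.pi = v (-Real.pi)) (hp' : v' Real.pi = v' (-Real.pi))
    (C : ℝ) (hC : ∀ x, ‖v'' x‖ ≤ C) : Summable (fun ξ => ‖fCoeff v ξ‖) := by
  have hcv : Continuous v' := continuous_iff_continuousAt.2 fun x => (hd' x).continuousAt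
  have h2 : ∀ ξ : ℤ, fCoeff v'' ξ = (Complex.I * ξ)^2 * fCoeff v ξ := by
    intro ξ
    rw [fCoeff_deriv v' v'' hd' hc hp', fCoeff_deriv v v' hd hcv hp]; ring
  have hs : Summable (fun ξ : ℤ => (C * (2 * Real.pi)) * (1 / (ξ:ℝ)^2)) :=
    (Real.summable_one_div_int_pow.2 (by norm_num)).mul_left _
  refine Summable.of_norm_bounded_eventually hs ?_
  rw [Filter.eventually_cofinite]
  refine (Set.finite_singleton (0:ℤ)).subset ?_
  intro ξ hξ
  by_contra h0
  apply hξ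
  have h0' : (ξ:ℝ) ≠ 0 := by exact_mod_cast h0
  have hh := fCoeff_norm_le v'' C hC ξ
  rw [h2, norm_mul, norm_pow, norm_mul, Complex.norm_I, one_mul] at hh
  have : ‖(ξ:ℂ)‖^2 = (ξ:ℝ)^2 := by
    rw [Complex.norm_intCast, sq_abs]
  rw [this] at hh
  rw [norm_norm, mul_one_div, le_div_iff₀ (by positivity)]
  linarith

lemma fourier_inv (v : ℝ → ℂ) (hc : Continuous v) (hp : Periodic v (2 * Real.pi))
    (hs : Summable (fun ξ => ‖fCoeff v ξ‖)) (x : ℝ) :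
    HasSum (fun ξ : ℤ => (1 / (2 * Real.pi)) * (fCoeff v ξ * Complex.exp (Complex.I * x * ξ))) (v x) := by
  have : Fact (0 < 2 * Real.pi) := ⟨by linarith [Real.pi_pos]⟩
  have hcl : Continuous (hp.lift) := continuous_coinduced_dom.mpr hc
  set F : C(AddCircle (2 * Real.pi), ℂ) := ⟨hp.lift, hcl⟩ with hF
  have hco : ∀ ξ : ℤ, fourierCoeff F ξ = (1 / (2 * Real.pi)) * fCoeff v ξ := by
    intro ξ
    rw [fourierCoeff_eq_intervalIntegral _ _ (-Real.pi), show -Real.pi + 2 * Real.pi = Real.pi by ring]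
    rw [fCoeff, Complex.real_smul]
    push_cast
    congr 1
    apply intervalIntegral.integral_congr
    intro y _
    have hy : (F : AddCircle (2*Real.pi) → ℂ) (y : AddCircle (2 * Real.pi)) = v y := hp.lift_coe y
    simp only [hy, smul_eq_mul]
    rw [fourier_coe_apply]
    congr 2
    have : (Real.pi : ℂ) ≠ 0 := by exact_mod_cast Real.pi_ne_zero
    push_cast
    field_simp
  have hs' : Summable (fourierCoeff F) := by
    have : fourierCoeff F = fun ξ => (1 / (2 * (Real.pi:ℂ))) * fCoeff v ξ := funext hco
    rw [this]
    exact (Summable.of_norm hs).mul_left _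
  have := has_pointwise_sum_fourier_series_of_summable hs' (x : AddCircle (2 * Real.pi))
  have hx : (F : AddCircle (2*Real.pi) → ℂ) (x : AddCircle (2 * Real.pi)) = v x := hp.lift_coe x
  rw [hx] at this
  convert! this using 1
  funext ξ
  rw [hco, fourier_coe_apply, smul_eq_mul]
  have hpi : (Real.pi : ℂ) ≠ 0 := by exact_mod_cast Real.pi_ne_zero
  have he : 2 * (Real.pi:ℂ) * Complex.I * ξ * x / ((2 * Real.pi : ℝ) : ℂ) = Complex.I * x * ξ := by
    push_cast
    field_simp
  rw [he]
  ring

lemma LP_conv (c : LPCutoff) (v : ℝ → ℂ) (hc : Continuous v) (hp : Periodic v (2 * Real.pi))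
    (hs : Summable (fun ξ => ‖fCoeff v ξ‖)) (x : ℝ) :
    Tendsto (fun K => ∑ k ∈ Finset.range K, LPblock c ((k:ℤ)-1) v x) atTop (nhds (v x)) := by
  rw [← tendsto_add_atTop_iff_nat 1]
  have hn : ∀ ξ : ℤ, ‖Complex.exp (Complex.I * x * ξ)‖ = 1 := by
    intro ξ
    have := Complex.norm_exp_ofReal_mul_I (x * ξ)
    rw [← this]; congr 2; push_cast; ring
  have hsum : ∀ k : ℕ, Summable (fun ξ : ℤ => (bMult c k ξ : ℂ) * fCoeff v ξ * Complex.exp (Complex.I * x * ξ)) := by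
    intro k
    apply summable_of_finite_support
    refine (bWin k).finite_toSet.subset ?_
    intro ξ hξ
    by_contra h
    apply hξ
    simp only
    rw [bMult_zero_of c k ξ (not_bWin h)]; simp
  have e : ∀ K : ℕ, ∑ k ∈ Finset.range (K+1), LPblock c ((k:ℤ)-1) v x =
      ∑' ξ : ℤ, (c.χ ((2:ℝ)^(-(K:ℤ)) * ξ) : ℂ) * ((1 / (2 * Real.pi)) * (fCoeff v ξ * Complex.exp (Complex.I * x * ξ))) := by
    intro K
    simp_rw [LPblock_eq]
    rw [← Finset.mul_sum, ← Summable.tsum_finsetSum (fun k _ => hsum k), ← tsum_mul_left]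
    congr 1
    funext ξ
    rw [← bMult_sum, ← Finset.sum_mul, ← Finset.sum_mul]
    push_cast
    ring
  simp_rw [e]
  rw [← (fourier_inv v hc hp hs x).tsum_eq]
  refine tendsto_tsum_of_dominated_convergence (bound := fun ξ => ‖(1 / (2 * Real.pi) : ℂ)‖ * ‖fCoeff v ξ‖)
    (hs.mul_left _) ?_ ?_
  · intro ξ
    have h0 : Tendsto (fun K : ℕ => (2:ℝ)^(-(K:ℤ)) * ξ) atTop (nhds 0) := by
      have : Tendsto (fun K : ℕ => ((1/2:ℝ))^K) atTop (nhds 0) :=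
        tendsto_pow_atTop_nhds_zero_of_lt_one (by norm_num) (by norm_num)
      have := this.mul_const (ξ:ℝ)
      rw [zero_mul] at this
      refine this.congr fun K => ?_
      rw [zpow_neg, zpow_natCast, one_div, inv_pow]
    have h1 : Tendsto (fun K : ℕ => c.χ ((2:ℝ)^(-(K:ℤ)) * ξ)) atTop (nhds (c.χ 0)) :=
      (c.smooth.continuous.tendsto 0).comp h0
    rw [c.eq_one 0 ⟨by norm_num, by norm_num⟩] at h1
    have h2 := ((Complex.continuous_ofReal.tendsto _).comp h1).mul_const
      ((1 / (2 * (Real.pi:ℂ))) * (fCoeff v ξ * Complex.exp (Complex.I * x * ξ)))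
    simpa using h2
  · refine Eventually.of_forall fun K ξ => ?_
    rw [norm_mul, norm_mul, norm_mul, hn, mul_one, Complex.norm_real,
      Real.norm_of_nonneg (c.nonneg _)]
    have := c.le_one ((2:ℝ)^(-(K:ℤ)) * ξ)
    exact mul_le_of_le_one_left (by positivity) this

/-- real smooth periodic function version -/
lemma besov_cons_real (c : LPCutoff) (v : ℝ → ℝ) (hv : ContDiff ℝ 2 v)
    (hp : Periodic v (2 * Real.pi)) (L : ℝ) (hL : 0 ≤ L)
    (hB : besov1E c (toC v) ≤ ENNReal.ofReal L) :
    (∀ x, |v x| ≤ 2 * L) ∧ (∀ x, |deriv v x| ≤ 6 * L) ∧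
    (∀ M q, ∑ m ∈ Finset.range M, 2^m * |fourPt v q (1/2^m)| ≤ 129 * L) := by
  have hd : ∀ x, HasDerivAt v (deriv v x) x := fun x =>
    (hv.differentiable (by norm_num) x).hasDerivAt
  have hv1 : ContDiff ℝ 1 (deriv v) := by
    have : ContDiff ℝ (1+1) v := by simpa [one_add_one_eq_two] using hv
    exact (contDiff_succ_iff_deriv.1 this).2.2
  have hd2 : ∀ x, HasDerivAt (deriv v) (deriv (deriv v) x) x := fun x =>
    (hv1.differentiable (by norm_num) x).hasDerivAt
  have hc2 : Continuous (deriv (deriv v)) := hv1.continuous_deriv (by norm_num)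
  have hp1 : Periodic (deriv v) (2 * Real.pi) := by
    intro x
    have : (fun y => v (y + 2 * Real.pi)) = v := funext hp
    rw [← deriv_comp_add_const, this]
  have hp2 : Periodic (deriv (deriv v)) (2 * Real.pi) := by
    intro x
    have : (fun y => deriv v (y + 2 * Real.pi)) = deriv v := funext hp1
    rw [← deriv_comp_add_const, this]
  obtain ⟨C, hC⟩ : ∃ C, ∀ x, ‖deriv (deriv v) x‖ ≤ C := by
    have hb := hp2.isBounded_of_continuous (by linarith [Real.pi_pos]) hc2
    obtain ⟨C, hC⟩ := hb.exists_norm_le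
    exact ⟨C, fun x => hC _ ⟨x, rfl⟩⟩
  have per : ∀ w : ℝ → ℝ, Periodic w (2 * Real.pi) → toC w Real.pi = toC w (-Real.pi) := by
    intro w hw
    have := hw (-Real.pi)
    rw [show -Real.pi + 2 * Real.pi = Real.pi by ring] at this
    simp [toC, this]
  have hs : Summable (fun ξ => ‖fCoeff (toC v) ξ‖) :=
    summable_fCoeff (toC v) (toC (deriv v)) (toC (deriv (deriv v)))
      (fun x => (hd x).ofReal_comp) (fun x => (hd2 x).ofReal_comp)
      (Complex.continuous_ofReal.comp hc2) (per _ hp) (per _ hp1) C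
      (fun x => by simpa [toC] using hC x)
  have hcv : Continuous (toC v) := Complex.continuous_ofReal.comp hv.continuous
  have hpv : Periodic (toC v) (2 * Real.pi) := fun x => by simp [toC, hp x]
  obtain ⟨h1, h2, h3⟩ := besov_cons c (toC v) L hL (LP_conv c _ hcv hpv hs) hB
  refine ⟨fun x => by simpa [toC] using h1 x, fun x => ?_, fun M q => ?_⟩
  · have hlip : LipschitzWith (Real.toNNReal (6 * L)) v := by
      apply LipschitzWith.of_dist_le_mul
      intro y x
      have := h2 x y
      rw [Real.coe_toNNReal _ (by positivity), Real.dist_eq, Real.dist_eq]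
      have e : toC v y - toC v x = ((v y - v x : ℝ) : ℂ) := by simp [toC]
      rw [e, Complex.norm_real] at this
      exact this
    have := norm_deriv_le_of_lipschitz (x₀ := x) hlip
    rwa [Real.coe_toNNReal _ (by positivity)] at this
  · refine le_trans (le_of_eq ?_) (h3 M q)
    refine Finset.sum_congr rfl fun m _ => ?_
    have : fourPt (toC v) q (1/2^m) = ((fourPt v q (1/2^m) : ℝ) : ℂ) := by
      simp [fourPt, toC]
    rw [this, Complex.norm_real]; rfl


/-- jointly smooth -/
def Sm (F : ℝ → ℝ → ℝ) : Prop := ContDiff ℝ (⊤ : ℕ∞) (Function.uncurry F)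

def dX (F : ℝ → ℝ → ℝ) : ℝ → ℝ → ℝ := fun t x => deriv (F t) x
def dT (F : ℝ → ℝ → ℝ) : ℝ → ℝ → ℝ := fun t x => deriv (fun s => F s x) t

lemma Sm.hasFDeriv {F : ℝ → ℝ → ℝ} (h : Sm F) (t x : ℝ) :
    HasFDerivAt (uncurry F) (fderiv ℝ (uncurry F) (t, x)) (t, x) :=
  (h.differentiable (by simp) (t, x)).hasFDerivAt

lemma Sm.line {F : ℝ → ℝ → ℝ} (h : Sm F) {s : Set ℝ} {X : ℝ → ℝ} {X' t : ℝ}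
    (hX : HasDerivWithinAt X X' s t) :
    HasDerivWithinAt (fun τ => F τ (X τ)) (fderiv ℝ (uncurry F) (t, X t) (1, X')) s t := by
  have h1 : HasDerivWithinAt (fun τ => (τ, X τ)) ((1:ℝ), X') s t :=
    (hasDerivWithinAt_id t s).prodMk hX
  exact (h.hasFDeriv t (X t)).comp_hasDerivWithinAt t h1

lemma Sm.dX_eq {F : ℝ → ℝ → ℝ} (h : Sm F) (t x : ℝ) :
    dX F t x = fderiv ℝ (uncurry F) (t, x) (0, 1) := by
  have h1 : HasDerivAt (fun y => (t, y)) ((0:ℝ), (1:ℝ)) x :=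
    (hasDerivAt_const x t).prodMk (hasDerivAt_id x)
  exact ((h.hasFDeriv t x).comp_hasDerivAt x h1).deriv

lemma Sm.dT_eq {F : ℝ → ℝ → ℝ} (h : Sm F) (t x : ℝ) :
    dT F t x = fderiv ℝ (uncurry F) (t, x) (1, 0) := by
  have h1 : HasDerivAt (fun y => (y, x)) ((1:ℝ), (0:ℝ)) t :=
    (hasDerivAt_id t).prodMk (hasDerivAt_const t x)
  exact ((h.hasFDeriv t x).comp_hasDerivAt t h1).deriv

lemma Sm.hasX {F : ℝ → ℝ → ℝ} (h : Sm F) (t x : ℝ) : HasDerivAt (F t) (dX F t x) x := by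
  have h1 : HasDerivAt (fun y => (t, y)) ((0:ℝ), (1:ℝ)) x :=
    (hasDerivAt_const x t).prodMk (hasDerivAt_id x)
  exact ((h.hasFDeriv t x).comp_hasDerivAt x h1).differentiableAt.hasDerivAt

lemma Sm.hasT {F : ℝ → ℝ → ℝ} (h : Sm F) (t x : ℝ) :
    HasDerivAt (fun s => F s x) (dT F t x) t := by
  have h1 : HasDerivAt (fun y => (y, x)) ((1:ℝ), (0:ℝ)) t :=
    (hasDerivAt_id t).prodMk (hasDerivAt_const t x)
  exact ((h.hasFDeriv t x).comp_hasDerivAt t h1).differentiableAt.hasDerivAt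

lemma Sm.chain {F : ℝ → ℝ → ℝ} (h : Sm F) {s : Set ℝ} {X : ℝ → ℝ} {X' t : ℝ}
    (hX : HasDerivWithinAt X X' s t) :
    HasDerivWithinAt (fun τ => F τ (X τ)) (dT F t (X t) + dX F t (X t) * X') s t := by
  convert! h.line hX using 1
  rw [h.dX_eq, h.dT_eq]
  have : ((1:ℝ), X') = (1, 0) + X' • ((0:ℝ), (1:ℝ)) := by simp
  rw [this, map_add, map_smul, smul_eq_mul, mul_comm]

lemma Sm.fd {F : ℝ → ℝ → ℝ} (h : Sm F) : ContDiff ℝ (⊤ : ℕ∞) (fderiv ℝ (uncurry F)) :=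
  h.fderiv_right (by simp)

lemma Sm.dX {F : ℝ → ℝ → ℝ} (h : Sm F) : Sm (dX F) := by
  have : uncurry (_root_.dX F) = fun p => fderiv ℝ (uncurry F) p (0, 1) := by
    funext ⟨t, x⟩; exact h.dX_eq t x
  rw [Sm, this]
  exact h.fd.clm_apply contDiff_const

lemma Sm.dT {F : ℝ → ℝ → ℝ} (h : Sm F) : Sm (dT F) := by
  have : uncurry (_root_.dT F) = fun p => fderiv ℝ (uncurry F) p (1, 0) := by
    funext ⟨t, x⟩; exact h.dT_eq t x
  rw [Sm, this]
  exact h.fd.clm_apply contDiff_const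

lemma Sm.comm {F : ℝ → ℝ → ℝ} (h : Sm F) (t x : ℝ) : _root_.dT (_root_.dX F) t x = _root_.dX (_root_.dT F) t x := by
  rw [h.dX.dT_eq, h.dT.dX_eq]
  have e1 : uncurry (_root_.dX F) = fun p => fderiv ℝ (uncurry F) p (0, 1) := by
    funext ⟨t, x⟩; exact h.dX_eq t x
  have e2 : uncurry (_root_.dT F) = fun p => fderiv ℝ (uncurry F) p (1, 0) := by
    funext ⟨t, x⟩; exact h.dT_eq t x
  have hd : DifferentiableAt ℝ (fderiv ℝ (uncurry F)) (t, x) := h.fd.differentiable (by simp) _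
  rw [e1, e2, fderiv_clm_apply hd (differentiableAt_const _),
    fderiv_clm_apply hd (differentiableAt_const _)]
  have hs : IsSymmSndFDerivAt ℝ (uncurry F) (t, x) :=
    (h.contDiffAt).isSymmSndFDerivAt (by simp; exact WithTop.coe_le_coe.2 (le_top : (2:ℕ∞) ≤ ⊤))
  simp
  exact hs _ _

lemma Sm.cont {F : ℝ → ℝ → ℝ} (h : Sm F) : Continuous (uncurry F) := h.continuous
lemma Sm.contX {F : ℝ → ℝ → ℝ} (h : Sm F) (t : ℝ) : Continuous (F t) :=
  h.continuous.comp (by fun_prop : Continuous fun x : ℝ => (t, x))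

lemma Sm.add {F K : ℝ → ℝ → ℝ} (h : Sm F) (k : Sm K) : Sm (fun t x => F t x + K t x) :=
  ContDiff.add h k
lemma Sm.mul {F K : ℝ → ℝ → ℝ} (h : Sm F) (k : Sm K) : Sm (fun t x => F t x * K t x) :=
  ContDiff.mul h k
lemma Sm.cmul {F : ℝ → ℝ → ℝ} (a : ℝ) (h : Sm F) : Sm (fun t x => a * F t x) :=
  ContDiff.mul contDiff_const h
lemma Sm.perX {F : ℝ → ℝ → ℝ} (hp : ∀ t, Periodic (F t) (2 * Real.pi)) (t : ℝ) :
    Periodic (_root_.dX F t) (2 * Real.pi) := by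
  intro x
  have : (fun y => F t (y + 2 * Real.pi)) = F t := funext (hp t)
  show deriv (F t) (x + 2 * Real.pi) = deriv (F t) x
  rw [← deriv_comp_add_const, this]
lemma Sm.perT {F : ℝ → ℝ → ℝ} (hp : ∀ t, Periodic (F t) (2 * Real.pi)) (t : ℝ) :
    Periodic (_root_.dT F t) (2 * Real.pi) := by
  intro x
  show deriv (fun s => F s (x + 2 * Real.pi)) t = deriv (fun s => F s x) t
  congr 1; funext s; exact hp s x

/-- primitive in space -/
def prim (g : ℝ → ℝ → ℝ) (t x : ℝ) : ℝ := ∫ y in (0:ℝ)..x, g t y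

lemma prim_hasT {g : ℝ → ℝ → ℝ} (h : Sm g) (t x : ℝ) :
    HasDerivAt (fun s => prim g s x) (prim (dT g) t x) t := by
  have hc : Continuous (uncurry (dT g)) := h.dT.cont
  obtain ⟨C, hC⟩ : ∃ C, ∀ p ∈ (Metric.closedBall t 1) ×ˢ (Set.uIcc 0 x), ‖uncurry (dT g) p‖ ≤ C :=
    ((isCompact_closedBall t 1).prod isCompact_uIcc).exists_bound_of_continuousOn hc.continuousOn
  refine (intervalIntegral.hasDerivAt_integral_of_dominated_loc_of_deriv_le (μ := volume) (F := g)
    (F' := dT g) (s := Metric.closedBall t 1) (bound := fun _ => C)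
    (Metric.closedBall_mem_nhds t one_pos) ?_ ?_ ?_ ?_ ?_ ?_).2
  · exact Eventually.of_forall fun s => (h.contX s).aestronglyMeasurable
  · exact (h.contX t).intervalIntegrable _ _
  · exact (h.dT.contX t).aestronglyMeasurable
  · refine Eventually.of_forall fun y hy s hs => ?_
    exact hC (s, y) ⟨hs, Set.uIoc_subset_uIcc hy⟩
  · exact intervalIntegrable_const
  · exact Eventually.of_forall fun y hy s hs => h.hasT s y

lemma prim_hasX {g : ℝ → ℝ → ℝ} (h : Sm g) (t x : ℝ) :
    HasDerivAt (prim g t) (g t x) x :=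
  intervalIntegral.integral_hasDerivAt_right ((h.contX t).intervalIntegrable _ _)
    ((h.contX t).stronglyMeasurableAtFilter _ _) (h.contX t).continuousAt

lemma prim_chain {g : ℝ → ℝ → ℝ} (h : Sm g) {s : Set ℝ} {X : ℝ → ℝ} {X' t : ℝ}
    (hX : HasDerivWithinAt X X' s t) :
    HasDerivWithinAt (fun τ => prim g τ (X τ)) (prim (dT g) t (X t) + g t (X t) * X') s t := by
  have key := hasStrictFDerivAt_uncurry_coprod (𝕜 := ℝ) (u := (t, X t)) (f := prim g)
    (f₁ := fun t x => ContinuousLinearMap.toSpanSingleton ℝ (prim (dT g) t x))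
    (f₂ := fun t x => ContinuousLinearMap.toSpanSingleton ℝ (g t x))
    (Eventually.of_forall fun v => (prim_hasT h v.1 v.2).hasFDerivAt)
    (Eventually.of_forall fun v => (prim_hasX h v.1 v.2).hasFDerivAt) ?_ ?_
  · have h1 : HasDerivWithinAt (fun τ => (τ, X τ)) ((1:ℝ), X') s t :=
      (hasDerivWithinAt_id t s).prodMk hX
    have := key.hasFDerivAt.comp_hasDerivWithinAt t h1
    convert! this using 1
    simp [HasUncurry.uncurry]
    ring
  · apply Continuous.continuousAt
    have h0 : Continuous (fun p : ℝ × ℝ => prim (dT g) p.1 p.2) :=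
      intervalIntegral.continuous_parametric_primitive_of_continuous h.dT.cont
    have h1 : Continuous (fun a : ℝ => ContinuousLinearMap.toSpanSingleton ℝ a) :=
      (ContinuousLinearMap.toSpanSingletonCLE (𝕜 := ℝ) (E := ℝ)).continuous
    exact h1.comp h0
  · apply Continuous.continuousAt
    have h1 : Continuous (fun a : ℝ => ContinuousLinearMap.toSpanSingleton ℝ a) :=
      (ContinuousLinearMap.toSpanSingletonCLE (𝕜 := ℝ) (E := ℝ)).continuous
    exact h1.comp h.cont


def wF (u : ℝ → ℝ → ℝ) (t x : ℝ) : ℝ := dT u t x + u t x * dX u t x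
def gF (u : ℝ → ℝ → ℝ) (t x : ℝ) : ℝ := dX u t x * dX u t x
def GF (u : ℝ → ℝ → ℝ) (t x : ℝ) : ℝ :=
  dT (dX u) t x + u t x * dX (dX u) t x + (1/2) * gF u t x

lemma wF_X {u : ℝ → ℝ → ℝ} (h : Sm u) (t x : ℝ) :
    HasDerivAt (wF u t) (GF u t x + (1/2) * gF u t x) x := by
  have := (h.dT.hasX t x).add ((h.hasX t x).mul (h.dX.hasX t x))
  convert! this using 1
  rw [GF, h.comm, gF]; ring

lemma GF_X {u : ℝ → ℝ → ℝ} {T : ℝ} (hs : IsCHSolution T u) {t : ℝ} (ht : t ∈ Set.Icc 0 T) (x : ℝ) :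
    HasDerivAt (GF u t) (wF u t x + 2 * u t x * dX u t x) x := by
  have h : Sm u := hs.1
  have := ((h.dX.dT.hasX t x).add ((h.hasX t x).mul (h.dX.dX.hasX t x))).add
    (((h.dX.hasX t x).mul (h.dX.hasX t x)).const_mul (1/2))
  convert! this using 1
  have e := hs.2.2 t ht x
  rw [← h.dX.comm]
  change dT u t x - dT (dX (dX u)) t x + 3 * u t x * dX u t x
    = 2 * dX u t x * dX (dX u) t x + u t x * dX (dX (dX u)) t x at e
  rw [wF]
  linarith

lemma maxp {s r : ℝ → ℝ} {ε R : ℝ} (hε : |ε| = 1) (hp : Periodic s (2 * Real.pi))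
    (hd : ∀ x, HasDerivAt s (ε * s x + r x) x) (hr : ∀ x, |r x| ≤ R) (x : ℝ) : |s x| ≤ R := by
  have hc : Continuous s := continuous_iff_continuousAt.2 fun x => (hd x).continuousAt
  have hcp : IsCompact (Set.range s) := hp.compact_of_continuous (by have := Real.pi_pos; positivity) hc
  have crit : ∀ y, IsLocalExtr s y → |s y| ≤ R := by
    intro y hy
    have h0 := hy.hasDerivAt_eq_zero (hd y)
    have : |ε * s y| = |r y| := by rw [show ε * s y = - r y by linarith, abs_neg]
    rw [abs_mul, hε, one_mul] at this
    rw [this]; exact hr y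
  obtain ⟨_, ⟨⟨y, rfl⟩, hy⟩⟩ := hcp.exists_isGreatest (Set.range_nonempty _)
  obtain ⟨_, ⟨⟨z, rfl⟩, hz⟩⟩ := hcp.exists_isLeast (Set.range_nonempty _)
  have h1 := abs_le.1 (crit y (Or.inr (Eventually.of_forall fun x => hy ⟨x, rfl⟩)))
  have h2 := abs_le.1 (crit z (Or.inl (Eventually.of_forall fun x => hz ⟨x, rfl⟩)))
  have h3 : s x ≤ s y := hy ⟨x, rfl⟩
  have h4 : s z ≤ s x := hz ⟨x, rfl⟩
  rw [abs_le]; constructor <;> linarith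

lemma wG_bd {u : ℝ → ℝ → ℝ} {T Λ : ℝ} (hs : IsCHSolution T u) {t : ℝ} (ht : t ∈ Set.Icc 0 T)
    (hb : ∀ x, |u t x| ≤ Λ ∧ |dX u t x| ≤ Λ) :
    (∀ x, |GF u t x| ≤ 3 * Λ^2) ∧ ∀ x, |wF u t x + 2 * u t x * dX u t x| ≤ 5 * Λ^2 := by
  have h : Sm u := hs.1
  have hpw : Periodic (wF u t) (2 * Real.pi) := fun x => by
    simp only [wF, Sm.perT hs.2.1 t x, hs.2.1 t x, Sm.perX hs.2.1 t x]
  have hpG : Periodic (GF u t) (2 * Real.pi) := fun x => by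
    simp only [GF, gF, Sm.perT (Sm.perX hs.2.1) t x, hs.2.1 t x, Sm.perX hs.2.1 t x,
      Sm.perX (Sm.perX hs.2.1) t x]
  have b1 : ∀ x, |gF u t x| ≤ Λ^2 := fun x => by
    rw [gF, abs_mul, sq]
    exact mul_le_mul (hb x).2 (hb x).2 (abs_nonneg _) ((abs_nonneg _).trans (hb x).2)
  have b2 : ∀ x, |u t x * dX u t x| ≤ Λ^2 := fun x => by
    rw [abs_mul, sq]
    exact mul_le_mul (hb x).1 (hb x).2 (abs_nonneg _) ((abs_nonneg _).trans (hb x).2)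
  have m1 := maxp (s := fun x => wF u t x + GF u t x)
    (r := fun x => (1/2) * gF u t x + 2 * (u t x * dX u t x)) (ε := 1) (R := 5/2 * Λ^2) (by simp)
    (fun x => by simp only [hpw x, hpG x])
    (fun x => by convert! (wF_X h t x).add (GF_X hs ht x) using 1; ring)
    (fun x => by
      have := abs_le.1 (b1 x); have := abs_le.1 (b2 x)
      rw [abs_le]; constructor <;> linarith)
  have m2 := maxp (s := fun x => wF u t x - GF u t x)
    (r := fun x => (1/2) * gF u t x - 2 * (u t x * dX u t x)) (ε := -1) (R := 5/2 * Λ^2) (by simp)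
    (fun x => by simp only [hpw x, hpG x])
    (fun x => by convert! (wF_X h t x).sub (GF_X hs ht x) using 1; ring)
    (fun x => by
      have := abs_le.1 (b1 x); have := abs_le.1 (b2 x)
      rw [abs_le]; constructor <;> linarith)
  have hL : 0 ≤ Λ^2 := sq_nonneg _
  constructor
  · intro x
    have := abs_le.1 (m1 x); have := abs_le.1 (m2 x)
    rw [abs_le]; constructor <;> linarith
  · intro x
    have := abs_le.1 (m1 x); have := abs_le.1 (m2 x); have := abs_le.1 (b2 x)
    rw [abs_le]; constructor <;> linarith

lemma traj {u : ℝ → ℝ → ℝ} {T Λ : ℝ} (h : Sm u) (hΛ : 0 ≤ Λ)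
    (hb : ∀ t ∈ Set.Icc 0 T, ∀ x, |u t x| ≤ Λ ∧ |dX u t x| ≤ Λ) {t0 : ℝ} (ht : t0 ∈ Set.Icc 0 T) (x0 : ℝ) :
    ∃ X : ℝ → ℝ, X t0 = x0 ∧ ∀ t ∈ Set.Icc 0 T, HasDerivWithinAt X (u t (X t)) (Set.Icc 0 T) t := by
  have hT : 0 ≤ T := ht.1.trans ht.2
  have hP : IsPicardLindelof u (tmin := 0) (tmax := T) ⟨t0, ht⟩ x0 (Real.toNNReal (Λ * T)) 0
      (Real.toNNReal Λ) (Real.toNNReal Λ) := by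
    constructor
    · intro t ht
      apply LipschitzOnWith.of_dist_le_mul
      intro x _ y _
      rw [Real.coe_toNNReal _ hΛ, Real.dist_eq, Real.dist_eq]
      exact Convex.norm_image_sub_le_of_norm_hasDerivWithin_le (s := Set.univ)
        (fun z _ => (h.hasX t z).hasDerivWithinAt) (fun z _ => (hb t ht z).2) convex_univ
        (Set.mem_univ _) (Set.mem_univ _)
    · intro x _
      exact (h.cont.comp (by fun_prop : Continuous fun t : ℝ => (t, x))).continuousOn
    · intro t ht x _
      rw [Real.coe_toNNReal _ hΛ]; exact (hb t ht x).1
    · rw [Real.coe_toNNReal _ hΛ, Real.coe_toNNReal _ (by positivity)]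
      simp only [NNReal.coe_zero, sub_zero]
      apply mul_le_mul_of_nonneg_left _ hΛ
      apply max_le
      · show T - t0 ≤ T
        linarith [ht.1]
      · exact ht.2
  exact hP.exists_eq_forall_mem_Icc_hasDerivWithinAt₀

lemma incr {T C : ℝ} {X X' : ℝ → ℝ} (hX : ∀ t ∈ Set.Icc 0 T, HasDerivWithinAt X (X' t) (Set.Icc 0 T) t)
    (hb : ∀ t ∈ Set.Icc 0 T, |X' t| ≤ C) {s t : ℝ} (hs : s ∈ Set.Icc 0 T) (ht : t ∈ Set.Icc 0 T) :
    |X t - X s| ≤ C * T := by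
  have h := Convex.norm_image_sub_le_of_norm_hasDerivWithin_le hX hb (convex_Icc 0 T) hs ht
  have hC : 0 ≤ C := (abs_nonneg _).trans (hb s hs)
  refine h.trans (mul_le_mul_of_nonneg_left ?_ hC)
  rw [Real.norm_eq_abs, abs_le]; constructor <;> linarith [hs.1, hs.2, ht.1, ht.2]

lemma maxpt {T : ℝ} (hT : 0 ≤ T) {X X' : ℝ → ℝ}
    (hX : ∀ t ∈ Set.Icc 0 T, HasDerivWithinAt X (X' t) (Set.Icc 0 T) t) :
    ∃ s ∈ Set.Icc 0 T, ∀ t ∈ Set.Icc 0 T, |X t| ≤ |X s| := by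
  have hc : ContinuousOn (fun t => |X t|) (Set.Icc 0 T) := fun t ht => (hX t ht).continuousWithinAt.abs
  obtain ⟨s, hs, h⟩ := isCompact_Icc.exists_isMaxOn ⟨0, ⟨le_rfl, hT⟩⟩ hc
  exact ⟨s, hs, fun t ht => h ht⟩

lemma sep {u : ℝ → ℝ → ℝ} {T Λ : ℝ} (h : Sm u) (hT : 0 ≤ T) (hΛ : 0 ≤ Λ) (hΛT : Λ * T ≤ 1/8)
    (hb : ∀ t ∈ Set.Icc 0 T, ∀ x, |u t x| ≤ Λ ∧ |dX u t x| ≤ Λ) {X Y : ℝ → ℝ}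
    (hX : ∀ t ∈ Set.Icc 0 T, HasDerivWithinAt X (u t (X t)) (Set.Icc 0 T) t)
    (hY : ∀ t ∈ Set.Icc 0 T, HasDerivWithinAt Y (u t (Y t)) (Set.Icc 0 T) t)
    {t : ℝ} (ht : t ∈ Set.Icc 0 T) :
    |(X t - Y t) - (X T - Y T)| ≤ |X T - Y T| / 7 := by
  have hD : ∀ t ∈ Set.Icc 0 T, HasDerivWithinAt (fun t => X t - Y t) (u t (X t) - u t (Y t)) (Set.Icc 0 T) t :=
    fun t ht => (hX t ht).sub (hY t ht)
  obtain ⟨s, hs, hm⟩ := maxpt hT hD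
  have hbd : ∀ t ∈ Set.Icc 0 T, |u t (X t) - u t (Y t)| ≤ Λ * |X s - Y s| := by
    intro t ht
    have := Convex.norm_image_sub_le_of_norm_hasDerivWithin_le (s := Set.univ) (x := Y t) (y := X t)
        (fun z _ => (h.hasX t z).hasDerivWithinAt) (fun z _ => (hb t ht z).2) convex_univ
        (Set.mem_univ _) (Set.mem_univ _)
    exact this.trans (mul_le_mul_of_nonneg_left (hm t ht) hΛ)
  have hTm : T ∈ Set.Icc 0 T := ⟨hT, le_rfl⟩
  have i1 := incr hD hbd hTm hs
  have i2 := incr hD hbd hTm ht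
  have i3 : Λ * |X s - Y s| * T ≤ |X s - Y s| / 8 := by
    nlinarith [abs_nonneg (X s - Y s)]
  have i4 : |X s - Y s| ≤ |X T - Y T| + |X s - Y s - (X T - Y T)| := by
    have := abs_add_le (X T - Y T) (X s - Y s - (X T - Y T))
    simpa using this
  linarith

/-- abstract second order ODE comparison -/
lemma odecmp {T Λ A B : ℝ} (hT : 0 ≤ T) (hΛ : 0 ≤ Λ) (hΛT : Λ * T ≤ 1/8) (hA : 0 ≤ A) (hAB : B * T ≤ 2 * A)
    {e e1 e2 v v1 G : ℝ → ℝ}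
    (he : ∀ t ∈ Set.Icc 0 T, HasDerivWithinAt e (e1 t) (Set.Icc 0 T) t)
    (he1 : ∀ t ∈ Set.Icc 0 T, HasDerivWithinAt e1 (e2 t) (Set.Icc 0 T) t)
    (hv : ∀ t ∈ Set.Icc 0 T, HasDerivWithinAt v (v1 t) (Set.Icc 0 T) t)
    (heT : e T = 0)
    (h1 : ∀ t ∈ Set.Icc 0 T, |e2 t - (1/2) * v t - G t * e t| ≤ A)
    (h2 : ∀ t ∈ Set.Icc 0 T, |v1 t - 2 * G t * e1 t| ≤ B)
    (hG : ∀ t ∈ Set.Icc 0 T, |G t| ≤ 3 * Λ^2) :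
    e1 T ≥ (1/2) * T * v 0 - (1/8) * T * |v 0| - 2 * |e1 0| - 3 * A * T ∧
    |e 0| ≤ T * (2 * |e1 0| + T * |v 0| + 3 * A * T) := by
  obtain ⟨s, hs, hm⟩ := maxpt hT he1
  set S := |e1 s| with hS
  have hS0 : 0 ≤ S := abs_nonneg _
  have hTm : T ∈ Set.Icc 0 T := ⟨hT, le_rfl⟩
  have h0m : (0:ℝ) ∈ Set.Icc 0 T := ⟨le_rfl, hT⟩
  have b0 : ∀ t ∈ Set.Icc 0 T, |e t| ≤ S * T := by
    intro t ht
    have := incr he hm hTm ht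
    rwa [heT, sub_zero] at this
  have bv1 : ∀ t ∈ Set.Icc 0 T, |v1 t| ≤ 6 * Λ^2 * S + B := by
    intro t ht
    have a1 : |2 * G t * e1 t| ≤ 6 * Λ^2 * S := by
      rw [abs_mul, abs_mul, abs_of_pos (by norm_num : (0:ℝ) < 2)]
      have := mul_le_mul (hG t ht) (hm t ht) (abs_nonneg _) (by positivity)
      linarith
    have := abs_le.1 (h2 t ht); have := abs_le.1 a1
    rw [abs_le]; constructor <;> linarith
  have bv : ∀ t ∈ Set.Icc 0 T, |v t - v 0| ≤ (6 * Λ^2 * S + B) * T := fun t ht => incr hv bv1 h0m ht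
  have be2 : ∀ t ∈ Set.Icc 0 T, |e2 t - (1/2) * v 0| ≤ 6 * Λ^2 * S * T + 2 * A := by
    intro t ht
    have a1 : |G t * e t| ≤ 3 * Λ^2 * (S * T) := by
      rw [abs_mul]
      exact mul_le_mul (hG t ht) (b0 t ht) (abs_nonneg _) (by positivity)
    have := abs_le.1 (h1 t ht); have := abs_le.1 a1; have := abs_le.1 (bv t ht)
    rw [abs_le]; constructor <;> nlinarith
  have hE : ∀ t ∈ Set.Icc 0 T, HasDerivWithinAt (fun t => e1 t - (1/2) * v 0 * t) (e2 t - (1/2) * v 0) (Set.Icc 0 T) t := by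
    intro t ht
    have := (he1 t ht).sub (((hasDerivWithinAt_id t (Set.Icc 0 T))).const_mul ((1/2) * v 0))
    convert! this using 1
    simp
  have hq : (6 * Λ^2 * S * T + 2 * A) * T ≤ S / 8 + 2 * A * T := by
    have : (Λ * T)^2 ≤ (1/8)^2 := pow_le_pow_left₀ (by positivity) hΛT 2
    have := mul_le_mul_of_nonneg_right this hS0
    nlinarith
  have bE : ∀ t ∈ Set.Icc 0 T, |e1 t - (1/2) * v 0 * t - e1 0| ≤ S / 8 + 2 * A * T := by
    intro t ht
    have := incr hE be2 h0m ht
    simp only [mul_zero, sub_zero] at this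
    exact this.trans hq
  have hST : S ≤ |e1 0| + (1/2) * T * |v 0| + S / 8 + 2 * A * T := by
    have a1 := bE s hs
    have a2 : |(1/2) * v 0 * s| ≤ (1/2) * T * |v 0| := by
      rw [abs_mul, abs_mul, abs_of_nonneg hs.1, abs_of_pos (by norm_num : (0:ℝ) < 1/2)]
      nlinarith [abs_nonneg (v 0), hs.2]
    have := abs_add_three (e1 0) ((1/2) * v 0 * s) (e1 s - (1/2) * v 0 * s - e1 0)
    rw [show e1 0 + (1/2) * v 0 * s + (e1 s - (1/2) * v 0 * s - e1 0) = e1 s by ring] at this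
    linarith
  have hAT : 0 ≤ A * T := by positivity
  have hvT : 0 ≤ T * |v 0| := by positivity
  have he0 := abs_nonneg (e1 0)
  constructor
  · have := abs_le.1 (bE T hTm)
    have := neg_abs_le (e1 0)
    nlinarith
  · have := b0 0 h0m
    have : S ≤ 2 * |e1 0| + T * |v 0| + 3 * A * T := by linarith
    nlinarith

lemma est {A B γ p : ℝ → ℝ} {a b γ0 κ P : ℝ} (hA : ∀ x, HasDerivAt A (γ x * p x) x)
    (hB : ∀ x, HasDerivAt B (p x) x) (hab : a ≤ b) (hκ : ∀ x ∈ Set.Icc a b, |γ x - γ0| ≤ κ)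
    (hP : ∀ x, |p x| ≤ P) : |(A b - A a) - γ0 * (B b - B a)| ≤ κ * P * (b - a) := by
  have := Convex.norm_image_sub_le_of_norm_hasDerivWithin_le (s := Set.Icc a b) (x := a) (y := b)
    (f := fun x => A x - γ0 * B x) (C := κ * P)
    (fun z _ => ((hA z).sub ((hB z).const_mul γ0)).hasDerivWithinAt)
    (fun z hz => by
      rw [show γ z * p z - γ0 * p z = (γ z - γ0) * p z by ring, norm_mul]
      exact mul_le_mul (hκ z hz) (hP z) (abs_nonneg _) ((abs_nonneg _).trans (hκ z hz)))
    (convex_Icc a b) (Set.left_mem_Icc.2 hab) (Set.right_mem_Icc.2 hab)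
  rw [Real.norm_eq_abs, Real.norm_eq_abs, abs_of_nonneg (sub_nonneg.2 hab)] at this
  rw [show A b - A a - γ0 * (B b - B a) = A b - γ0 * B b - (A a - γ0 * B a) by ring]
  exact this


lemma gF_sm {u : ℝ → ℝ → ℝ} (h : Sm u) : Sm (gF u) := h.dX.mul h.dX
lemma GF_sm {u : ℝ → ℝ → ℝ} (h : Sm u) : Sm (GF u) :=
  ((h.dX.dT).add (h.mul h.dX.dX)).add ((gF_sm h).cmul (1/2))

def kF (u : ℝ → ℝ → ℝ) (t x : ℝ) : ℝ := GF u t x * (2 * dX u t x)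
lemma kF_sm {u : ℝ → ℝ → ℝ} (h : Sm u) : Sm (kF u) := (GF_sm h).mul (h.dX.cmul 2)

lemma prim_dT_gF {u : ℝ → ℝ → ℝ} (h : Sm u) (t x : ℝ) :
    prim (dT (gF u)) t x = prim (kF u) t x - (u t x * gF u t x - u t 0 * gF u t 0) := by
  have hug : Sm (fun t x => u t x * gF u t x) := h.mul (gF_sm h)
  have e : ∀ y, dT (gF u) t y = kF u t y - dX (fun t x => u t x * gF u t x) t y := by
    intro y
    have e1 : dT (gF u) t y = dT (dX u) t y * dX u t y + dX u t y * dT (dX u) t y :=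
      ((h.dX.hasT t y).mul (h.dX.hasT t y)).deriv
    have e2 : dX (fun t x => u t x * gF u t x) t y = dX u t y * gF u t y +
        u t y * (dX (dX u) t y * dX u t y + dX u t y * dX (dX u) t y) :=
      ((h.hasX t y).mul ((h.dX.hasX t y).mul (h.dX.hasX t y))).deriv
    rw [e1, e2, kF, GF, gF]; ring
  unfold prim
  simp_rw [e]
  rw [intervalIntegral.integral_sub (((kF_sm h).contX t).intervalIntegrable _ _)
    ((hug.dX.contX t).intervalIntegrable _ _)]
  congr 1
  exact intervalIntegral.integral_eq_sub_of_hasDerivAt (fun y _ => hug.hasX t y)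
    ((hug.dX.contX t).intervalIntegrable _ _)

lemma ch_key {u : ℝ → ℝ → ℝ} {T Λ : ℝ} (hT : 0 ≤ T) (hΛ : 0 ≤ Λ) (hΛT : Λ * T ≤ 1/8)
    (hs : IsCHSolution T u)
    (hb : ∀ t ∈ Set.Icc 0 T, ∀ x, |u t x| ≤ Λ ∧ |deriv (u t) x| ≤ Λ) :
    ∃ q, ∀ h > 0, ∃ y1 y2 z1 z2 : ℝ, |y1 - h| ≤ h/7 ∧ |(y2 - y1) - h| ≤ h/7 ∧
      |z1 + h| ≤ h/7 ∧ |(z1 - z2) - h| ≤ h/7 ∧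
      ∀ l0 l1 l2, l0 = (y2 - y1) - (z1 - z2) → l1 = (u 0 y2 - u 0 y1) - (u 0 z1 - u 0 z2) →
        l2 = (∫ y in y1..y2, deriv (u 0) y * deriv (u 0) y) - (∫ y in z2..z1, deriv (u 0) y * deriv (u 0) y) →
        fourPt (u T) q h ≥ (1/2) * T * l2 - (1/8) * T * |l2| - 2 * |l1| - 12 * Λ * h^2 ∧
        |l0| ≤ T * (2 * |l1| + T * |l2| + 12 * Λ * h^2) := by
  have h : Sm u := hs.1
  have hTm : T ∈ Set.Icc 0 T := ⟨hT, le_rfl⟩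
  have h0m : (0:ℝ) ∈ Set.Icc 0 T := ⟨le_rfl, hT⟩
  obtain ⟨X0, hX00, hX0⟩ := traj h hΛ hb h0m 0
  refine ⟨X0 T, fun d hd => ?_⟩
  obtain ⟨X1, hX1T, hX1⟩ := traj h hΛ hb hTm (X0 T + d)
  obtain ⟨X2, hX2T, hX2⟩ := traj h hΛ hb hTm (X0 T + 2 * d)
  obtain ⟨Y1, hY1T, hY1⟩ := traj h hΛ hb hTm (X0 T - d)
  obtain ⟨Y2, hY2T, hY2⟩ := traj h hΛ hb hTm (X0 T - 2 * d)
  have s10 : ∀ t ∈ Set.Icc 0 T, |(X1 t - X0 t) - d| ≤ d / 7 := fun t ht => by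
    have := sep h hT hΛ hΛT hb hX1 hX0 ht
    rwa [hX1T, show X0 T + d - X0 T = d by ring, abs_of_pos hd] at this
  have s21 : ∀ t ∈ Set.Icc 0 T, |(X2 t - X1 t) - d| ≤ d / 7 := fun t ht => by
    have := sep h hT hΛ hΛT hb hX2 hX1 ht
    rwa [hX1T, hX2T, show X0 T + 2 * d - (X0 T + d) = d by ring, abs_of_pos hd] at this
  have r10 : ∀ t ∈ Set.Icc 0 T, |(X0 t - Y1 t) - d| ≤ d / 7 := fun t ht => by
    have := sep h hT hΛ hΛT hb hX0 hY1 ht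
    rwa [hY1T, show X0 T - (X0 T - d) = d by ring, abs_of_pos hd] at this
  have r21 : ∀ t ∈ Set.Icc 0 T, |(Y1 t - Y2 t) - d| ≤ d / 7 := fun t ht => by
    have := sep h hT hΛ hΛT hb hY1 hY2 ht
    rwa [hY1T, hY2T, show X0 T - d - (X0 T - 2 * d) = d by ring, abs_of_pos hd] at this
  have hU : ∀ X : ℝ → ℝ, (∀ t ∈ Set.Icc 0 T, HasDerivWithinAt X (u t (X t)) (Set.Icc 0 T) t) →
      ∀ t ∈ Set.Icc 0 T, HasDerivWithinAt (fun τ => u τ (X τ)) (wF u t (X t)) (Set.Icc 0 T) t := by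
    intro X hX t ht
    convert! h.chain (hX t ht) using 1
    rw [wF]; ring
  have hP : ∀ X : ℝ → ℝ, (∀ t ∈ Set.Icc 0 T, HasDerivWithinAt X (u t (X t)) (Set.Icc 0 T) t) →
      ∀ t ∈ Set.Icc 0 T, HasDerivWithinAt (fun τ => prim (gF u) τ (X τ))
        (prim (kF u) t (X t) + u t 0 * gF u t 0) (Set.Icc 0 T) t := by
    intro X hX t ht
    convert! prim_chain (gF_sm h) (hX t ht) using 1
    rw [prim_dT_gF h]; ring
  have hbG := fun t (ht : t ∈ Set.Icc 0 T) => wG_bd hs ht (hb t ht)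
  have lipG : ∀ t ∈ Set.Icc 0 T, ∀ x y, |GF u t x - GF u t y| ≤ 5 * Λ^2 * |x - y| := fun t ht x y =>
    Convex.norm_image_sub_le_of_norm_hasDerivWithin_le (s := Set.univ) (x := y) (y := x)
        (fun z _ => (GF_X hs ht z).hasDerivWithinAt) (fun z _ => (hbG t ht).2 z) convex_univ
        (Set.mem_univ _) (Set.mem_univ _)
  have κe : ∀ t ∈ Set.Icc 0 T, ∀ x, |x - X0 t| ≤ 16/7 * d →
      |GF u t x - GF u t (X0 t)| ≤ 5 * Λ^2 * (16/7 * d) := fun t ht x hx =>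
    (lipG t ht x (X0 t)).trans (mul_le_mul_of_nonneg_left hx (by positivity))
  have κX : ∀ t ∈ Set.Icc 0 T, ∀ x ∈ Set.Icc (X1 t) (X2 t), |GF u t x - GF u t (X0 t)| ≤ 5 * Λ^2 * (16/7 * d) := by
    intro t ht x hx
    apply κe t ht
    have := abs_le.1 (s10 t ht); have := abs_le.1 (s21 t ht)
    rw [abs_le]; constructor <;> linarith [hx.1, hx.2]
  have κY : ∀ t ∈ Set.Icc 0 T, ∀ x ∈ Set.Icc (Y2 t) (Y1 t), |GF u t x - GF u t (X0 t)| ≤ 5 * Λ^2 * (16/7 * d) := by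
    intro t ht x hx
    apply κe t ht
    have := abs_le.1 (r10 t ht); have := abs_le.1 (r21 t ht)
    rw [abs_le]; constructor <;> linarith [hx.1, hx.2]
  have E1 : ∀ t ∈ Set.Icc 0 T, ∀ a b, a ≤ b → b - a ≤ 8/7 * d →
      (∀ x ∈ Set.Icc a b, |GF u t x - GF u t (X0 t)| ≤ 5 * Λ^2 * (16/7 * d)) →
      |(wF u t b - wF u t a) - (1/2) * (prim (gF u) t b - prim (gF u) t a) - GF u t (X0 t) * (b - a)| ≤ 15 * Λ^2 * d^2 := by
    intro t ht a b hab hba hk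
    have := est (A := fun x => wF u t x - (1/2) * prim (gF u) t x) (B := fun x => x) (γ := GF u t)
      (p := fun _ => 1) (P := 1)
      (fun x => by
        convert! (wF_X h t x).sub ((prim_hasX (gF_sm h) t x).const_mul (1/2)) using 1; ring)
      (fun x => hasDerivAt_id x) hab hk (by simp)
    rw [show wF u t b - wF u t a - 1 / 2 * (prim (gF u) t b - prim (gF u) t a) =
      wF u t b - 1 / 2 * prim (gF u) t b - (wF u t a - 1 / 2 * prim (gF u) t a) by ring]
    refine this.trans ?_
    have := mul_le_mul_of_nonneg_left hba (by positivity : 0 ≤ 5 * Λ^2 * (16/7 * d) * 1)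
    have : 0 ≤ Λ^2 * d^2 := by positivity
    nlinarith
  have E2 : ∀ t ∈ Set.Icc 0 T, ∀ a b, a ≤ b → b - a ≤ 8/7 * d →
      (∀ x ∈ Set.Icc a b, |GF u t x - GF u t (X0 t)| ≤ 5 * Λ^2 * (16/7 * d)) →
      |(prim (kF u) t b - prim (kF u) t a) - GF u t (X0 t) * (2 * u t b - 2 * u t a)| ≤ 30 * Λ^3 * d^2 := by
    intro t ht a b hab hba hk
    have := est (A := fun x => prim (kF u) t x) (B := fun x => 2 * u t x) (γ := GF u t)
      (p := fun x => 2 * dX u t x) (P := 2 * Λ)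
      (fun x => prim_hasX (kF_sm h) t x)
      (fun x => (h.hasX t x).const_mul 2) hab hk
      (fun x => by
        rw [abs_mul, abs_of_pos (by norm_num : (0:ℝ) < 2)]
        exact mul_le_mul_of_nonneg_left (hb t ht x).2 (by norm_num))
    refine this.trans ?_
    have := mul_le_mul_of_nonneg_left hba (by positivity : 0 ≤ 5 * Λ^2 * (16/7 * d) * (2 * Λ))
    have : 0 ≤ Λ^3 * d^2 := by positivity
    nlinarith
  have main := odecmp (A := 30 * Λ^2 * d^2) (B := 60 * Λ^3 * d^2) hT hΛ hΛT (by positivity)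
    (by have := mul_le_mul_of_nonneg_left hΛT (by positivity : 0 ≤ 60 * Λ^2 * d^2)
        have : 0 ≤ Λ^2 * d^2 := by positivity
        nlinarith)
    (e := fun t => (X2 t - X1 t) - (Y1 t - Y2 t))
    (e1 := fun t => (u t (X2 t) - u t (X1 t)) - (u t (Y1 t) - u t (Y2 t)))
    (e2 := fun t => (wF u t (X2 t) - wF u t (X1 t)) - (wF u t (Y1 t) - wF u t (Y2 t)))
    (v := fun t => (prim (gF u) t (X2 t) - prim (gF u) t (X1 t)) - (prim (gF u) t (Y1 t) - prim (gF u) t (Y2 t)))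
    (v1 := fun t => (prim (kF u) t (X2 t) - prim (kF u) t (X1 t)) - (prim (kF u) t (Y1 t) - prim (kF u) t (Y2 t)))
    (G := fun t => GF u t (X0 t))
    (fun t ht => ((hX2 t ht).sub (hX1 t ht)).sub ((hY1 t ht).sub (hY2 t ht)))
    (fun t ht => ((hU _ hX2 t ht).sub (hU _ hX1 t ht)).sub ((hU _ hY1 t ht).sub (hU _ hY2 t ht)))
    (fun t ht => by
      convert! ((hP _ hX2 t ht).sub (hP _ hX1 t ht)).sub ((hP _ hY1 t ht).sub (hP _ hY2 t ht)) using 1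
      ring)
    (by simp only [hX1T, hX2T, hY1T, hY2T]; ring)
    (fun t ht => by
      have a1 := abs_le.1 (s21 t ht); have a2 := abs_le.1 (r21 t ht)
      have b1 := abs_le.1 (E1 t ht (X1 t) (X2 t) (by linarith) (by linarith) (κX t ht))
      have b2 := abs_le.1 (E1 t ht (Y2 t) (Y1 t) (by linarith) (by linarith) (κY t ht))
      rw [abs_le]; constructor <;> linarith)
    (fun t ht => by
      have a1 := abs_le.1 (s21 t ht); have a2 := abs_le.1 (r21 t ht)
      have b1 := abs_le.1 (E2 t ht (X1 t) (X2 t) (by linarith) (by linarith) (κX t ht))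
      have b2 := abs_le.1 (E2 t ht (Y2 t) (Y1 t) (by linarith) (by linarith) (κY t ht))
      rw [abs_le]; constructor <;> linarith)
    (fun t ht => (hbG t ht).1 _)
  refine ⟨X1 0, X2 0, Y1 0, Y2 0, ?_, s21 0 h0m, ?_, r21 0 h0m, ?_⟩
  · have := s10 0 h0m
    rwa [hX00, sub_zero] at this
  · have := r10 0 h0m
    rw [hX00, ← abs_neg] at this
    rwa [show Y1 0 + d = -(0 - Y1 0 - d) by ring]
  · intro l0 l1 l2 e0 e1 e2
    have ii : ∀ a b, IntervalIntegrable (fun y => deriv (u 0) y * deriv (u 0) y) volume a b := fun a b =>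
      ((gF_sm h).contX 0).intervalIntegrable a b
    have ev : l2 = (prim (gF u) 0 (X2 0) - prim (gF u) 0 (X1 0)) - (prim (gF u) 0 (Y1 0) - prim (gF u) 0 (Y2 0)) := by
      rw [e2]
      have k1 := intervalIntegral.integral_add_adjacent_intervals (ii 0 (X1 0)) (ii (X1 0) (X2 0))
      have k2 := intervalIntegral.integral_add_adjacent_intervals (ii 0 (Y2 0)) (ii (Y2 0) (Y1 0))
      unfold prim gF dX
      linarith
    simp only [← ev, ← e0, ← e1] at main
    have hA : 3 * (30 * Λ^2 * d^2) * T ≤ 12 * Λ * d^2 := by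
      have := mul_le_mul_of_nonneg_left hΛT (by positivity : 0 ≤ 90 * Λ * d^2)
      have : 0 ≤ Λ * d^2 := by positivity
      nlinarith
    constructor
    · have m1 := main.1
      rw [hX1T, hX2T, hY1T, hY2T] at m1
      unfold fourPt
      linarith
    · refine main.2.trans (mul_le_mul_of_nonneg_left (by linarith) hT)


/-- partial sums of the square wave -/
def sqS (K : ℕ) (y : ℝ) : ℝ :=
  ∑ k ∈ Finset.range K, 2 / (Real.pi * (2 * k + 1)) * Real.sin ((2 * k + 1) * y)

lemma sum_cos_odd (K : ℕ) (y : ℝ) :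
    2 * Real.sin y * ∑ k ∈ Finset.range K, Real.cos ((2 * k + 1) * y) = Real.sin (2 * K * y) := by
  induction K with
  | zero => simp
  | succ K ih =>
    rw [Finset.sum_range_succ, mul_add, ih]
    push_cast
    rw [show 2 * ((K:ℝ) + 1) * y = (2 * K + 1) * y + y by ring,
      show 2 * (K:ℝ) * y = (2 * K + 1) * y - y by ring, Real.sin_add, Real.sin_sub]
    ring

lemma sqS_deriv (K : ℕ) (y : ℝ) :
    HasDerivAt (sqS K) (2 / Real.pi * ∑ k ∈ Finset.range K, Real.cos ((2 * k + 1) * y)) y := by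
  unfold sqS
  rw [Finset.mul_sum]
  apply HasDerivAt.fun_sum
  intro k _
  have h1 : HasDerivAt (fun y : ℝ => (2 * (k:ℝ) + 1) * y) (2 * k + 1) y := by
    simpa using (hasDerivAt_id y).const_mul (2 * (k:ℝ) + 1)
  have := (h1.sin).const_mul (2 / (Real.pi * (2 * k + 1)))
  convert! this using 1
  have : (2 * (k:ℝ) + 1) ≠ 0 := by positivity
  have := Real.pi_ne_zero
  field_simp

lemma sqS_osc (K : ℕ) (hK : 0 < K) {y : ℝ} (hy : 0 < y) (hy2 : y ≤ Real.pi / 2) :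
    |sqS K y - sqS K (Real.pi / 2)| ≤ 1 / (2 * K * y) := by
  have hπ := Real.pi_pos
  set M : ℝ := 2 * K with hM
  have hM0 : 0 < M := by positivity
  have hsin : ∀ t ∈ Set.Icc y (Real.pi / 2), 0 < Real.sin t := fun t ht =>
    Real.sin_pos_of_pos_of_lt_pi (by linarith [ht.1]) (by linarith [ht.2])
  have hcos : ∀ t ∈ Set.Icc y (Real.pi / 2), 0 ≤ Real.cos t := fun t ht =>
    Real.cos_nonneg_of_neg_pi_div_two_le_of_le (by linarith [ht.1]) (by linarith [ht.2])
  have hp : ∀ t ∈ Set.Icc y (Real.pi / 2), HasDerivAt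
      (fun t => Real.pi * sqS K t + Real.cos (M * t) / (M * Real.sin t))
      (-(Real.cos (M * t) * Real.cos t / (M * Real.sin t ^ 2))) t := by
    intro t ht
    have h0 := (hsin t ht).ne'
    have h1 : HasDerivAt (fun y : ℝ => M * y) M t := by simpa using (hasDerivAt_id t).const_mul M
    have := ((sqS_deriv K t).const_mul Real.pi).add ((h1.cos).div ((Real.hasDerivAt_sin t).const_mul M) (by positivity))
    convert! this using 1
    have e := sum_cos_odd K t
    rw [← hM] at e
    have e' : ∑ k ∈ Finset.range K, Real.cos ((2 * k + 1) * t) = Real.sin (M * t) / (2 * Real.sin t) := by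
      rw [eq_div_iff (by positivity), ← e]; ring
    rw [e']
    field_simp
    ring
  have hr : ∀ t ∈ Set.Icc y (Real.pi / 2), HasDerivAt (fun t => 1 / (M * Real.sin t))
      (-(Real.cos t / (M * Real.sin t ^ 2))) t := by
    intro t ht
    have h0 := (hsin t ht).ne'
    have := (hasDerivAt_const t (1:ℝ)).div ((Real.hasDerivAt_sin t).const_mul M) (by positivity)
    convert! this using 1
    field_simp
    ring
  have hyI : y ∈ Set.Icc y (Real.pi / 2) := ⟨le_rfl, hy2⟩
  have hpI : Real.pi / 2 ∈ Set.Icc y (Real.pi / 2) := ⟨hy2, le_rfl⟩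
  have q : ∀ t ∈ Set.Icc y (Real.pi / 2), |Real.cos (M * t) * Real.cos t / (M * Real.sin t ^ 2)| ≤
      Real.cos t / (M * Real.sin t ^ 2) := by
    intro t ht
    have h0 := hsin t ht
    rw [abs_div, abs_mul, abs_of_nonneg (hcos t ht), abs_of_pos (by positivity : 0 < M * Real.sin t ^ 2)]
    gcongr
    exact mul_le_of_le_one_left (hcos t ht) (Real.abs_cos_le_one _)
  have a1 : AntitoneOn (fun t => (Real.pi * sqS K t + Real.cos (M * t) / (M * Real.sin t)) + 1 / (M * Real.sin t))
      (Set.Icc y (Real.pi / 2)) := by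
    apply antitoneOn_of_hasDerivWithinAt_nonpos (convex_Icc _ _)
    · exact fun t ht => ((hp t ht).add (hr t ht)).continuousAt.continuousWithinAt
    · exact fun t ht => ((hp t (interior_subset ht)).add (hr t (interior_subset ht))).hasDerivWithinAt
    · intro t ht
      have := abs_le.1 (q t (interior_subset ht))
      linarith
  have a2 : MonotoneOn (fun t => (Real.pi * sqS K t + Real.cos (M * t) / (M * Real.sin t)) - 1 / (M * Real.sin t))
      (Set.Icc y (Real.pi / 2)) := by
    apply monotoneOn_of_hasDerivWithinAt_nonneg (convex_Icc _ _)
    · exact fun t ht => ((hp t ht).sub (hr t ht)).continuousAt.continuousWithinAt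
    · exact fun t ht => ((hp t (interior_subset ht)).sub (hr t (interior_subset ht))).hasDerivWithinAt
    · intro t ht
      have := abs_le.1 (q t (interior_subset ht))
      linarith
  have b1 := a1 hyI hpI hy2
  have b2 := a2 hyI hpI hy2
  simp only [Real.sin_pi_div_two, mul_one] at b1 b2
  have hs := hsin y hyI
  have c1 : |Real.cos (M * y) / (M * Real.sin y)| ≤ 1 / (M * Real.sin y) := by
    rw [abs_div, abs_of_pos (by positivity : 0 < M * Real.sin y)]
    gcongr; exact Real.abs_cos_le_one _
  have c2 : |Real.cos (M * (Real.pi / 2)) / M| ≤ 1 / M := by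
    rw [abs_div, abs_of_pos hM0]
    gcongr; exact Real.abs_cos_le_one _
  have c3 : 1 / (M * Real.sin y) ≤ (Real.pi / 2) * (1 / (M * y)) := by
    have := Real.mul_le_sin hy.le hy2
    rw [show (Real.pi / 2) * (1 / (M * y)) = 1 / (M * (2 / Real.pi * y)) by field_simp]
    gcongr
  have c1 := abs_le.1 c1
  have c2 := abs_le.1 c2
  have : |Real.pi * (sqS K y - sqS K (Real.pi / 2))| ≤ Real.pi * (1 / (M * y)) := by
    rw [abs_le]; constructor <;> linarith
  rw [abs_mul, abs_of_pos hπ] at this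
  exact le_of_mul_le_mul_left this hπ

lemma sqS_half : Tendsto (fun K => sqS K (Real.pi / 2)) atTop (nhds (1/2)) := by
  have h := (Real.tendsto_sum_pi_div_four).const_mul (2 / Real.pi)
  have e : 2 / Real.pi * (Real.pi / 4) = 1 / 2 := by
    have := Real.pi_ne_zero
    field_simp; norm_num
  rw [e] at h
  refine h.congr fun K => ?_
  rw [sqS, Finset.mul_sum]
  refine Finset.sum_congr rfl fun k _ => ?_
  have : Real.sin ((2 * k + 1) * (Real.pi / 2)) = (-1)^k := by
    rw [show (2 * (k:ℝ) + 1) * (Real.pi / 2) = Real.pi / 2 + k * Real.pi by ring, Real.sin_add_nat_mul_pi]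
    simp
  rw [this]
  have := Real.pi_ne_zero
  field_simp

lemma sqS_small (K : ℕ) (y : ℝ) : |sqS K y| ≤ K * |y| := by
  rw [sqS]
  refine (Finset.abs_sum_le_sum_abs _ _).trans ?_
  have : ∀ k ∈ Finset.range K, |2 / (Real.pi * (2 * k + 1)) * Real.sin ((2 * k + 1) * y)| ≤ |y| := by
    intro k _
    rw [abs_mul, abs_of_pos (by have := Real.pi_pos; positivity)]
    have h1 := Real.abs_sin_le_abs (x := (2 * k + 1) * y)
    rw [abs_mul, abs_of_pos (by positivity : (0:ℝ) < 2 * k + 1)] at h1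
    have hπ := Real.pi_gt_three
    calc 2 / (Real.pi * (2 * k + 1)) * |Real.sin ((2 * k + 1) * y)|
        ≤ 2 / (Real.pi * (2 * k + 1)) * ((2 * k + 1) * |y|) := by gcongr
      _ = 2 / Real.pi * |y| := by field_simp
      _ ≤ 1 * |y| := by
        gcongr
        rw [div_le_one (by linarith)]; linarith
      _ = |y| := one_mul _
  refine (Finset.sum_le_sum this).trans ?_
  simp

lemma sqS_pi (K : ℕ) (y : ℝ) : sqS K (y + Real.pi) = - sqS K y := by
  rw [sqS, sqS, ← Finset.sum_neg_distrib]
  refine Finset.sum_congr rfl fun k _ => ?_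
  have : Real.sin ((2 * k + 1) * (y + Real.pi)) = - Real.sin ((2 * k + 1) * y) := by
    rw [show (2 * (k:ℝ) + 1) * (y + Real.pi) = ((2 * k + 1) * y + Real.pi) + k * (2 * Real.pi) by ring,
      Real.sin_add_nat_mul_two_pi, Real.sin_add_pi]
  rw [this]; ring

lemma sqS_neg (K : ℕ) (y : ℝ) : sqS K (-y) = - sqS K y := by
  rw [sqS, sqS, ← Finset.sum_neg_distrib]
  refine Finset.sum_congr rfl fun k _ => ?_
  rw [mul_neg, Real.sin_neg]; ring

lemma sqS_facts : ∃ K0 : ℕ, 0 < K0 ∧ ∀ K ≥ K0, (∀ y, |sqS K y| ≤ 2) ∧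
    ∀ y, 0 < y → y ≤ Real.pi / 2 → 8 ≤ 2 * K * y → 1/4 ≤ sqS K y := by
  obtain ⟨K0, h0⟩ := Metric.tendsto_atTop.1 sqS_half (1/8) (by norm_num)
  refine ⟨K0 + 1, by omega, fun K hK => ?_⟩
  have hK' : 0 < K := by omega
  have h1 := h0 K (by omega)
  rw [Real.dist_eq] at h1
  have h1 := abs_lt.1 h1
  constructor
  · have base : ∀ y, 0 ≤ y → y ≤ Real.pi / 2 → |sqS K y| ≤ 2 := by
      intro y hy hy2
      rcases le_total (2 * K * y) 1 with h | h
      · have := sqS_small K y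
        rw [abs_of_nonneg hy] at this
        linarith
      · have hy0 : 0 < y := by
          rcases hy.eq_or_lt with h' | h'
          · rw [← h'] at h; norm_num at h
          · exact h'
        have h2 := sqS_osc K hK' hy0 hy2
        have h3 : 1 / (2 * K * y) ≤ 1 := by rw [div_le_one (by linarith)]; exact h
        have := abs_le.1 h2
        rw [abs_le]; constructor <;> linarith
    intro y
    have hper : Periodic (fun y => |sqS K y|) Real.pi := fun y => by simp [sqS_pi]
    obtain ⟨z, hz, hyz⟩ := hper.exists_mem_Ico₀ Real.pi_pos y
    change |sqS K y| = |sqS K z| at hyz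
    rw [hyz]
    rcases le_total z (Real.pi / 2) with h | h
    · exact base z hz.1 h
    · have := base (Real.pi - z) (by linarith [hz.2]) (by linarith)
      rwa [show Real.pi - z = -z + Real.pi by ring, sqS_pi, sqS_neg, neg_neg] at this
  · intro y hy hy2 h
    have h2 := abs_le.1 (sqS_osc K hK' hy hy2)
    have h3 : 1 / (2 * K * y) ≤ 1/8 := by gcongr
    linarith

/-- the real form of `f_n`, `n = 2 r` -/
def fR (c : LPCutoff) (r : ℕ) (x : ℝ) : ℝ :=
  ∑ k ∈ Finset.range (2^r), c.χ ((2:ℝ)^(-(r:ℤ)) * (2 * k + 1)) *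
    (2 / (Real.pi * (2 * k + 1)) * Real.sin ((2 * k + 1) * x))

def fR' (c : LPCutoff) (r : ℕ) (x : ℝ) : ℝ :=
  ∑ k ∈ Finset.range (2^r), c.χ ((2:ℝ)^(-(r:ℤ)) * (2 * k + 1)) *
    (2 / Real.pi * Real.cos ((2 * k + 1) * x))

lemma fR_deriv (c : LPCutoff) (r : ℕ) (x : ℝ) : HasDerivAt (fR c r) (fR' c r x) x := by
  unfold fR fR'
  apply HasDerivAt.fun_sum
  intro k _
  have h1 : HasDerivAt (fun y : ℝ => (2 * (k:ℝ) + 1) * y) (2 * k + 1) x := by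
    simpa using (hasDerivAt_id x).const_mul (2 * (k:ℝ) + 1)
  have := ((h1.sin).const_mul (2 / (Real.pi * (2 * k + 1)))).const_mul (c.χ ((2:ℝ)^(-(r:ℤ)) * (2 * k + 1)))
  convert! this using 1
  have : (2 * (k:ℝ) + 1) ≠ 0 := by positivity
  have := Real.pi_ne_zero
  field_simp

lemma fR'_bd (c : LPCutoff) (r : ℕ) (x : ℝ) : |fR' c r x| ≤ 2^r := by
  rw [fR']
  refine (Finset.abs_sum_le_sum_abs _ _).trans ?_
  have : ∀ k ∈ Finset.range (2^r), |c.χ ((2:ℝ)^(-(r:ℤ)) * (2 * k + 1)) *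
    (2 / Real.pi * Real.cos ((2 * k + 1) * x))| ≤ 1 := by
    intro k _
    have hπ := Real.pi_gt_three
    rw [abs_mul, abs_of_nonneg (c.nonneg _), abs_mul, abs_of_pos (by positivity)]
    have h1 : 2 / Real.pi ≤ 1 := by rw [div_le_one (by linarith)]; linarith
    exact mul_le_one₀ (c.le_one _) (by positivity) (mul_le_one₀ h1 (abs_nonneg _) (Real.abs_cos_le_one _))
  refine (Finset.sum_le_sum this).trans ?_
  simp

lemma fR_neg (c : LPCutoff) (r : ℕ) (y : ℝ) : fR c r (-y) = - fR c r y := by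
  rw [fR, fR, ← Finset.sum_neg_distrib]
  refine Finset.sum_congr rfl fun k _ => ?_
  rw [mul_neg, Real.sin_neg]; ring

lemma fR_abel (c : LPCutoff) (r : ℕ) (hr : 1 ≤ r) (x A B : ℝ)
    (h : ∀ K : ℕ, (2:ℝ)^r / 2 ≤ 2 * K → A ≤ sqS K x ∧ sqS K x ≤ B) : A ≤ fR c r x ∧ fR c r x ≤ B := by
  set g : ℕ → ℝ := fun k => c.χ ((2:ℝ)^(-(r:ℤ)) * (2 * k + 1)) with hg
  have h2r : (2:ℝ) ≤ 2^r := by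
    calc (2:ℝ) = 2^1 := by norm_num
      _ ≤ 2^r := pow_le_pow_right₀ (by norm_num) hr
  have abel : ∀ K : ℕ, ∑ k ∈ Finset.range K, g k * (2 / (Real.pi * (2 * k + 1)) * Real.sin ((2 * k + 1) * x))
      = (∑ k ∈ Finset.range K, (g k - g (k+1)) * sqS (k+1) x) + g K * sqS K x := by
    intro K
    induction K with
    | zero => simp [sqS]
    | succ K ih =>
      rw [Finset.sum_range_succ, ih, Finset.sum_range_succ]
      have : sqS (K+1) x = sqS K x + 2 / (Real.pi * (2 * K + 1)) * Real.sin ((2 * K + 1) * x) := by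
        rw [sqS, Finset.sum_range_succ, sqS]
      rw [this]; ring
  have hz : (2:ℝ)^(-(r:ℤ)) = 1 / 2^r := by rw [zpow_neg, zpow_natCast, one_div]
  have gK : g (2^r) = 0 := by
    apply c.zero_of_ge
    rw [hz, abs_of_pos (by positivity)]
    push_cast
    rw [one_div_mul_eq_div, le_div_iff₀ (by positivity)]
    linarith
  have g0 : g 0 = 1 := by
    apply c.eq_one
    rw [hz]
    constructor
    · have : (0:ℝ) ≤ 1 / 2^r * (2 * ((0:ℕ):ℝ) + 1) := by positivity
      linarith
    · simp only [Nat.cast_zero, mul_zero, zero_add, mul_one]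
      rw [div_le_iff₀ (by positivity)]; linarith
  have gmono : ∀ k, 0 ≤ g k - g (k+1) := by
    intro k
    rw [sub_nonneg]
    apply c.decay
    · exact Set.mem_Ici.2 (by positivity)
    · exact Set.mem_Ici.2 (by positivity)
    · gcongr; simp
  have gone : ∀ k : ℕ, 2 * ((k+1 : ℕ):ℝ) < 2^r / 2 → g k - g (k+1) = 0 := by
    have : ∀ k : ℕ, 2 * (k:ℝ) < 2^r / 2 → g k = 1 := by
      intro k hk
      apply c.eq_one
      rw [hz]
      constructor
      · have : (0:ℝ) ≤ 1 / 2^r * (2 * (k:ℝ) + 1) := by positivity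
        linarith
      · rw [one_div_mul_eq_div, div_le_iff₀ (by positivity)]
        have : (2 * k) < 2^(r-1) := by
          have e : (2:ℝ)^r / 2 = 2^(r-1) := by
            obtain ⟨s, rfl⟩ : ∃ s, r = s + 1 := ⟨r - 1, by omega⟩
            simp [pow_succ]
          rw [e] at hk
          exact_mod_cast hk
        rcases hr.eq_or_lt with h1 | h1
        · rw [← h1] at this ⊢
          simp at this
          rw [this]; norm_num
        · have h4 : (4:ℝ) ≤ 2^r := by
            calc (4:ℝ) = 2^2 := by norm_num
              _ ≤ 2^r := pow_le_pow_right₀ (by norm_num) h1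
          linarith
    intro k hk
    rw [this (k+1) hk, this k (by push_cast at hk; linarith), sub_self]
  have wsum : ∑ k ∈ Finset.range (2^r), (g k - g (k+1)) = 1 := by
    rw [Finset.sum_range_sub', g0, gK, sub_zero]
  have hf : fR c r x = ∑ k ∈ Finset.range (2^r), (g k - g (k+1)) * sqS (k+1) x := by
    have := abel (2^r)
    rw [gK, zero_mul, add_zero] at this
    exact this
  rw [hf]
  constructor
  · calc A = ∑ k ∈ Finset.range (2^r), (g k - g (k+1)) * A := by rw [← Finset.sum_mul, wsum, one_mul]
      _ ≤ _ := by
        refine Finset.sum_le_sum fun k _ => ?_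
        rcases lt_or_ge (2 * ((k+1 : ℕ):ℝ)) (2^r / 2) with h' | h'
        · rw [gone k h']; simp
        · exact mul_le_mul_of_nonneg_left (h (k+1) h').1 (gmono k)
  · calc _ ≤ ∑ k ∈ Finset.range (2^r), (g k - g (k+1)) * B := by
          refine Finset.sum_le_sum fun k _ => ?_
          rcases lt_or_ge (2 * ((k+1 : ℕ):ℝ)) (2^r / 2) with h' | h'
          · rw [gone k h']; simp
          · exact mul_le_mul_of_nonneg_left (h (k+1) h').2 (gmono k)
      _ = B := by rw [← Finset.sum_mul, wsum, one_mul]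

lemma fR_facts (c : LPCutoff) : ∃ r0 : ℕ, ∀ r ≥ r0, (∀ y, |fR c r y| ≤ 2) ∧
    ∀ y, 0 < y → y ≤ Real.pi / 2 → 16 ≤ 2^r * y → 1/4 ≤ fR c r y := by
  obtain ⟨K0, hK0, h⟩ := sqS_facts
  refine ⟨4 * K0, fun r hr => ?_⟩
  have hbig : ∀ K : ℕ, (2:ℝ)^r / 2 ≤ 2 * K → K ≥ K0 := by
    intro K hK
    have h1 : (r:ℝ) < 2^r := by exact_mod_cast Nat.lt_two_pow_self
    have h2 : (4 * K0 : ℝ) ≤ r := by exact_mod_cast hr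
    have : (K0:ℝ) ≤ K := by linarith
    exact_mod_cast this
  constructor
  · intro y
    rw [abs_le]
    exact fR_abel c r (by omega) y (-2) 2 fun K hK => abs_le.1 ((h K (hbig K hK)).1 y)
  · intro y hy hy2 h16
    refine (fR_abel c r (by omega) y (1/4) 2 fun K hK => ⟨?_, (abs_le.1 ((h K (hbig K hK)).1 y)).2⟩).1
    refine (h K (hbig K hK)).2 y hy hy2 ?_
    have := mul_le_mul_of_nonneg_right hK hy.le
    linarith


lemma exp_per_int (ξ : ℤ) : Complex.exp (-Complex.I * (Real.pi:ℝ) * ξ) = (-1)^ξ := by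
  rw [show -Complex.I * ((Real.pi:ℝ):ℂ) * ξ = ((-ξ:ℤ):ℂ) * (Real.pi * Complex.I) by push_cast; ring,
    Complex.exp_int_mul, Complex.exp_pi_mul_I, zpow_neg, ← inv_zpow]
  norm_num

lemma hFun_pos {x : ℝ} (h : x ∈ Set.Ioo 0 Real.pi) : hFun x = 1/2 := by
  have hπ := Real.pi_pos
  have : ⌊(x + Real.pi) / (2 * Real.pi)⌋ = 0 := by
    rw [Int.floor_eq_zero_iff]
    constructor
    · have := h.1; positivity
    · rw [div_lt_one (by positivity)]; linarith [h.2]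
  have h1 := h.1
  unfold hFun
  simp only [this]
  rw [if_neg, if_pos]
  · simpa using h1
  · push Not
    constructor
    · simpa using h1.ne'
    · simp; linarith

lemma hFun_neg {x : ℝ} (h : x ∈ Set.Ioo (-Real.pi) 0) : hFun x = -1/2 := by
  have hπ := Real.pi_pos
  have h1 := h.1
  have h2 := h.2
  have : ⌊(x + Real.pi) / (2 * Real.pi)⌋ = 0 := by
    rw [Int.floor_eq_zero_iff]
    constructor
    · apply div_nonneg <;> linarith
    · rw [div_lt_one (by positivity)]; linarith [h.2]
  unfold hFun
  simp only [this]
  rw [if_neg, if_neg]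
  · simp; linarith
  · push Not
    constructor
    · simpa using h2.ne
    · simp; linarith

lemma fCoeff_hFun_split (ξ : ℤ) : fCoeff (toC hFun) ξ =
    (∫ x in (-Real.pi)..0, Complex.exp (-Complex.I * x * ξ)) * (-1/2) +
    (∫ x in (0:ℝ)..Real.pi, Complex.exp (-Complex.I * x * ξ)) * (1/2) := by
  have hπ := Real.pi_pos
  have c1 : ∀ a b : ℝ, IntervalIntegrable (fun x : ℝ => Complex.exp (-Complex.I * x * ξ) * (-1/2)) volume a b :=
    fun a b => by apply Continuous.intervalIntegrable; fun_prop
  have c2 : ∀ a b : ℝ, IntervalIntegrable (fun x : ℝ => Complex.exp (-Complex.I * x * ξ) * (1/2)) volume a b :=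
    fun a b => by apply Continuous.intervalIntegrable; fun_prop
  have e1 : Set.EqOn (fun x : ℝ => Complex.exp (-Complex.I * x * ξ) * (-1/2))
      (fun x : ℝ => Complex.exp (-Complex.I * x * ξ) * toC hFun x) (Set.uIoo (-Real.pi) 0) := by
    intro x hx
    rw [Set.uIoo_of_le (by linarith)] at hx
    simp [toC, hFun_neg hx]
  have e2 : Set.EqOn (fun x : ℝ => Complex.exp (-Complex.I * x * ξ) * (1/2))
      (fun x : ℝ => Complex.exp (-Complex.I * x * ξ) * toC hFun x) (Set.uIoo 0 Real.pi) := by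
    intro x hx
    rw [Set.uIoo_of_le (by linarith)] at hx
    simp [toC, hFun_pos hx]
  rw [fCoeff, ← intervalIntegral.integral_add_adjacent_intervals (b := 0)
    ((c1 _ _).congr_uIoo e1) ((c2 _ _).congr_uIoo e2),
    ← intervalIntegral.integral_congr_uIoo e1, ← intervalIntegral.integral_congr_uIoo e2,
    intervalIntegral.integral_mul_const, intervalIntegral.integral_mul_const]

lemma exp_prim (ξ : ℤ) (hξ : ξ ≠ 0) (a b : ℝ) : (∫ x in a..b, Complex.exp (-Complex.I * x * ξ)) =
    (Complex.exp (-Complex.I * b * ξ) - Complex.exp (-Complex.I * a * ξ)) * (Complex.I / ξ) := by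
  have hξ' : (ξ:ℂ) ≠ 0 := by exact_mod_cast hξ
  rw [intervalIntegral.integral_eq_sub_of_hasDerivAt
    (f := fun x : ℝ => Complex.exp (-Complex.I * x * ξ) * (Complex.I / ξ))]
  · ring
  · intro x _
    have := (exp_hasDerivAt ξ x).mul_const (Complex.I / ξ)
    convert! this using 1
    field_simp
    rw [Complex.I_sq]; ring
  · apply Continuous.intervalIntegrable; fun_prop

lemma fCoeff_hFun_even (ξ : ℤ) (h : Even ξ) : fCoeff (toC hFun) ξ = 0 := by
  rw [fCoeff_hFun_split]
  by_cases h0 : ξ = 0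
  · subst h0; simp; ring
  · rw [exp_prim _ h0, exp_prim _ h0, ← exp_pi_eq, exp_per_int, h.neg_one_zpow]
    simp

lemma fCoeff_hFun_odd (ξ : ℤ) (h : Odd ξ) : fCoeff (toC hFun) ξ = -2 * Complex.I / ξ := by
  have h0 : ξ ≠ 0 := by rintro rfl; simp at h
  rw [fCoeff_hFun_split, exp_prim _ h0, exp_prim _ h0, ← exp_pi_eq, exp_per_int, h.neg_one_zpow]
  simp; ring

lemma fLow_eq (c : LPCutoff) (r : ℕ) : fLow c (2 * r) = fR c r := by
  funext x
  have hdiv : (((2 * r : ℕ) : ℤ) / 2) = r := by push_cast; omega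
  let g : ℤ → ℂ := fun ξ => (c.χ ((2:ℝ) ^ (-(r:ℤ)) * ξ) : ℂ) * fCoeff (toC hFun) ξ *
    Complex.exp (Complex.I * x * ξ)
  have key : ∑' ξ : ℤ, g ξ = ∑ k ∈ Finset.range (2^r), (g (2 * k + 1) + g (-(2 * k + 1))) := by
    have i1 : Set.InjOn (fun k : ℕ => (2 * (k:ℤ) + 1)) (Finset.range (2^r)) := by
      intro a _ b _ h; simp at h; exact h
    have i2 : Set.InjOn (fun k : ℕ => (-(2 * (k:ℤ) + 1))) (Finset.range (2^r)) := by
      intro a _ b _ h; simp at h; exact h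
    rw [tsum_eq_sum (s := (Finset.range (2^r)).image (fun k : ℕ => (2 * (k:ℤ) + 1)) ∪
      (Finset.range (2^r)).image (fun k : ℕ => (-(2 * (k:ℤ) + 1)))), Finset.sum_union,
      Finset.sum_image i1, Finset.sum_image i2, Finset.sum_add_distrib]
    · rw [Finset.disjoint_left]
      intro a h1 h2
      simp only [Finset.mem_image] at h1 h2
      obtain ⟨k, _, hk⟩ := h1
      obtain ⟨l, _, hl⟩ := h2
      omega
    · intro ξ hξ
      rcases Int.even_or_odd ξ with h | h
      · simp [g, fCoeff_hFun_even ξ h]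
      · have : c.χ ((2:ℝ) ^ (-(r:ℤ)) * ξ) = 0 := by
          apply c.zero_of_ge
          have h2 : (2:ℤ)^(r+1) ≤ |ξ| := by
            by_contra hlt
            push Not at hlt
            rw [pow_succ] at hlt
            apply hξ
            obtain ⟨m, hm⟩ := h
            rw [abs_lt] at hlt
            rw [Finset.mem_union, Finset.mem_image, Finset.mem_image]
            rcases le_or_gt 0 m with hm0 | hm0
            · left; refine ⟨m.toNat, ?_, by omega⟩
              rw [Finset.mem_range]; zify; rw [Int.toNat_of_nonneg hm0]; omega
            · right; refine ⟨(-m-1).toNat, ?_, by omega⟩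
              rw [Finset.mem_range]; zify; rw [Int.toNat_of_nonneg (by omega)]; omega
          have h3 : (2:ℝ)^(r+1) ≤ |(ξ:ℝ)| := by exact_mod_cast h2
          rw [abs_mul, abs_of_pos (by positivity : (0:ℝ) < (2:ℝ)^(-(r:ℤ))), zpow_neg, zpow_natCast,
            inv_mul_eq_div, le_div_iff₀ (by positivity)]
          rw [pow_succ] at h3
          have : (0:ℝ) < 2^r := by positivity
          linarith
        simp only [g, this]; simp
  have h2 : LPlow c r (toC hFun) x = (fR c r x : ℝ) := by
    rw [LPlow, key, fR, Finset.mul_sum]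
    push_cast
    apply Finset.sum_congr rfl
    intro k _
    simp only [g]
    rw [fCoeff_hFun_odd _ ⟨k, rfl⟩, fCoeff_hFun_odd _ (Odd.neg ⟨k, rfl⟩)]
    have hne : (2 * (k:ℂ) + 1) ≠ 0 := by
      have : (2 * (k:ℝ) + 1) ≠ 0 := by positivity
      exact_mod_cast this
    have hπ : (Real.pi:ℂ) ≠ 0 := by exact_mod_cast Real.pi_ne_zero
    push_cast
    rw [mul_neg, c.even, Complex.sin]
    rw [show Complex.I * (x:ℂ) * -(2 * (k:ℂ) + 1) = -((2 * (k:ℂ) + 1) * x) * Complex.I by ring,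
      show Complex.I * (x:ℂ) * (2 * (k:ℂ) + 1) = ((2 * (k:ℂ) + 1) * x) * Complex.I by ring]
    field_simp
    ring
  rw [fLow, hdiv, h2, Complex.ofReal_re]

/-! linear structure of the blocks -/

def Blk (c : LPCutoff) (k : ℕ) (u v : ℝ → ℂ) : Prop :=
  Continuous u ∧ ∀ x, LPblock c ((k:ℤ) - 1) u x = v x

lemma fCoeff_add (u v : ℝ → ℂ) (hu : Continuous u) (hv : Continuous v) (ξ : ℤ) :
    fCoeff (fun x => u x + v x) ξ = fCoeff u ξ + fCoeff v ξ := by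
  unfold fCoeff
  rw [← intervalIntegral.integral_add (by apply Continuous.intervalIntegrable; fun_prop)
    (by apply Continuous.intervalIntegrable; fun_prop)]
  simp only [mul_add]

lemma fCoeff_smul (a : ℂ) (u : ℝ → ℂ) (ξ : ℤ) :
    fCoeff (fun x => a * u x) ξ = a * fCoeff u ξ := by
  unfold fCoeff
  rw [← intervalIntegral.integral_const_mul]
  congr 1; funext x; ring

lemma Blk.add {c : LPCutoff} {k : ℕ} {u v u' v' : ℝ → ℂ} (h : Blk c k u v) (h' : Blk c k u' v') :
    Blk c k (fun x => u x + u' x) (fun x => v x + v' x) := by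
  refine ⟨h.1.add h'.1, fun x => ?_⟩
  beta_reduce
  rw [← h.2, ← h'.2, LPblock_trigP, LPblock_trigP, LPblock_trigP]
  unfold trigP
  rw [← Finset.sum_add_distrib]
  refine Finset.sum_congr rfl fun ξ _ => ?_
  beta_reduce
  rw [fCoeff_add _ _ h.1 h'.1]; ring

lemma Blk.smul {c : LPCutoff} {k : ℕ} {u v : ℝ → ℂ} (a : ℂ) (h : Blk c k u v) :
    Blk c k (fun x => a * u x) (fun x => a * v x) := by
  refine ⟨continuous_const.mul h.1, fun x => ?_⟩
  beta_reduce
  rw [← h.2, LPblock_trigP, LPblock_trigP]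
  unfold trigP
  rw [Finset.mul_sum]
  refine Finset.sum_congr rfl fun ξ _ => ?_
  beta_reduce
  rw [fCoeff_smul]; ring

lemma Blk.sum {c : LPCutoff} {k : ℕ} (s : Finset ℕ) {u v : ℕ → ℝ → ℂ} (h : ∀ i, Blk c k (u i) (v i)) :
    Blk c k (fun x => ∑ i ∈ s, u i x) (fun x => ∑ i ∈ s, v i x) := by
  induction s using Finset.induction_on with
  | empty =>
    have := (h 0).smul 0
    simpa using this
  | insert i s hi ih =>
    simp only [Finset.sum_insert hi]
    exact (h i).add ih

lemma fCoeff_exp (η ξ : ℤ) : fCoeff (fun x => Complex.exp (Complex.I * x * η)) ξ =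
    if ξ = η then (2 * Real.pi : ℂ) else 0 := by
  unfold fCoeff
  have e : ∀ x : ℝ, Complex.exp (-Complex.I * x * ξ) * Complex.exp (Complex.I * x * η) =
      Complex.exp (-Complex.I * x * ((ξ - η : ℤ):ℂ)) := by
    intro x; rw [← Complex.exp_add]; congr 1; push_cast; ring
  simp only [e]
  split_ifs with h
  · subst h; simp; ring
  · rw [exp_prim _ (by omega), exp_pi_eq]; ring

lemma Blk.exp (c : LPCutoff) (k : ℕ) (η : ℤ) : Blk c k (fun x => Complex.exp (Complex.I * x * η))
    (fun x => bMult c k η * Complex.exp (Complex.I * x * η)) := by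
  refine ⟨by fun_prop, fun x => ?_⟩
  have hπ : (Real.pi:ℂ) ≠ 0 := by exact_mod_cast Real.pi_ne_zero
  rw [LPblock_eq, tsum_eq_single η]
  · rw [fCoeff_exp, if_pos rfl]; field_simp
  · intro ξ h
    rw [fCoeff_exp, if_neg h]; ring

lemma bMult_neg (c : LPCutoff) (k : ℕ) (η : ℤ) : bMult c k (-η) = bMult c k η := by
  cases k with
  | zero => simp [bMult, c.even]
  | succ k => rw [bMult_succ, bMult_succ]; push_cast; rw [mul_neg, mul_neg, c.even, c.even]

lemma Blk.cos (c : LPCutoff) (k : ℕ) (η : ℤ) : Blk c k (fun x : ℝ => (Real.cos (η * x) : ℂ))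
    (fun x : ℝ => (bMult c k η * Real.cos (η * x) : ℝ)) := by
  have := ((Blk.exp c k η).add (Blk.exp c k (-η))).smul (1/2)
  rw [bMult_neg] at this
  convert! this using 2 with x x
  · push_cast
    rw [Complex.cos, show Complex.I * (x:ℂ) * -(η:ℂ) = -((η:ℂ) * x) * Complex.I by ring,
      show Complex.I * (x:ℂ) * (η:ℂ) = ((η:ℂ) * x) * Complex.I by ring]; ring
  · push_cast
    rw [Complex.cos, show Complex.I * (x:ℂ) * -(η:ℂ) = -((η:ℂ) * x) * Complex.I by ring,
      show Complex.I * (x:ℂ) * (η:ℂ) = ((η:ℂ) * x) * Complex.I by ring]; ring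

lemma Blk.sin (c : LPCutoff) (k : ℕ) (η : ℤ) : Blk c k (fun x : ℝ => (Real.sin (η * x) : ℂ))
    (fun x : ℝ => (bMult c k η * Real.sin (η * x) : ℝ)) := by
  have := ((Blk.exp c k (-η)).add ((Blk.exp c k η).smul (-1))).smul (Complex.I/2)
  rw [bMult_neg] at this
  convert! this using 2 with x x
  · push_cast
    rw [Complex.sin, show Complex.I * (x:ℂ) * -(η:ℂ) = -((η:ℂ) * x) * Complex.I by ring,
      show Complex.I * (x:ℂ) * (η:ℂ) = ((η:ℂ) * x) * Complex.I by ring]; ring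
  · push_cast
    rw [Complex.sin, show Complex.I * (x:ℂ) * -(η:ℂ) = -((η:ℂ) * x) * Complex.I by ring,
      show Complex.I * (x:ℂ) * (η:ℂ) = ((η:ℂ) * x) * Complex.I by ring]; ring


def uS (c : LPCutoff) (r : ℕ) (c0 δ : ℝ) (x : ℝ) : ℝ :=
  c0 * Real.cos ((2:ℝ)^(2*r) * x) * (1 + δ * fR c r x)

/-- coefficients -/
def aS (c : LPCutoff) (r k : ℕ) : ℝ :=
  c.χ ((2:ℝ)^(-(r:ℤ)) * (2 * k + 1)) * (2 / (Real.pi * (2 * k + 1)))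

lemma aS_bd (c : LPCutoff) (r k : ℕ) : |aS c r k| ≤ 1 := by
  have hπ := Real.pi_gt_three
  have h1 := c.nonneg ((2:ℝ)^(-(r:ℤ)) * (2 * k + 1))
  have h2 := c.le_one ((2:ℝ)^(-(r:ℤ)) * (2 * k + 1))
  have h3 : 2 / (Real.pi * (2 * k + 1)) ≤ 1 := by
    rw [div_le_one (by positivity)]
    have : (0:ℝ) ≤ k := by positivity
    nlinarith
  have h4 : 0 ≤ 2 / (Real.pi * (2 * k + 1)) := by positivity
  rw [aS, abs_of_nonneg (by positivity)]
  nlinarith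

def wS (c : LPCutoff) (r : ℕ) (c0 δ : ℝ) (b : ℤ → ℝ) (x : ℝ) : ℝ :=
  c0 * (b (2^(2*r)) * Real.cos (((2^(2*r) : ℤ) : ℝ) * x) + δ * ∑ k ∈ Finset.range (2^r), aS c r k *
    (1/2 * (b (2^(2*r) + (2*k+1)) * Real.sin (((2^(2*r) + (2*k+1) : ℤ) : ℝ) * x) +
      (-1) * (b (2^(2*r) - (2*k+1)) * Real.sin (((2^(2*r) - (2*k+1) : ℤ) : ℝ) * x)))))

lemma uS_eq_wS (c : LPCutoff) (r : ℕ) (c0 δ x : ℝ) : uS c r c0 δ x = wS c r c0 δ (fun _ => 1) x := by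
  unfold uS wS
  rw [mul_assoc]
  congr 1
  rw [mul_add, mul_one]
  congr 1
  · simp
  · rw [mul_left_comm]
    congr 1
    rw [fR, Finset.mul_sum]
    refine Finset.sum_congr rfl fun k _ => ?_
    push_cast
    generalize hz : (2 * (k:ℝ) + 1) = z
    rw [add_mul, sub_mul, Real.sin_add, Real.sin_sub, aS, hz]
    ring

lemma uS_block (c : LPCutoff) (r k : ℕ) (c0 δ : ℝ) :
    Blk c k (toC (uS c r c0 δ)) (toC (wS c r c0 δ (bMult c k))) := by
  have h := ((Blk.cos c k (2^(2*r))).add ((Blk.sum (Finset.range (2^r)) (fun i =>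
    (((Blk.sin c k (2^(2*r) + (2*i+1))).add ((Blk.sin c k (2^(2*r) - (2*i+1))).smul (-1))).smul
      (1/2)).smul (aS c r i : ℂ))).smul (δ:ℂ))).smul (c0:ℂ)
  have e : toC (uS c r c0 δ) = toC (wS c r c0 δ (fun _ => 1)) := by
    funext x; rw [toC, uS_eq_wS]; rfl
  rw [e]
  convert! h using 2 with x x
  · simp only [toC, wS]; push_cast; simp only [one_mul]
  · simp only [toC, wS]; push_cast; rfl

lemma wS_bd (c : LPCutoff) (r : ℕ) (c0 δ : ℝ) (hδ : 0 ≤ δ) (hδ1 : δ ≤ 1) (b : ℤ → ℝ) (D : ℝ)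
    (hf : ∀ y, |fR c r y| ≤ 2)
    (hb : ∀ k : ℕ, k < 2^r → |b (2^(2*r) + (2*k+1)) - b (2^(2*r))| ≤ D ∧ |b (2^(2*r) - (2*k+1)) - b (2^(2*r))| ≤ D)
    (x : ℝ) : |wS c r c0 δ b x| ≤ |c0| * (3 * |b (2^(2*r))| + 2^r * D) := by
  set N : ℤ := 2^(2*r) with hN
  have e : wS c r c0 δ b x = c0 * (b N * (Real.cos ((2:ℝ)^(2*r) * x) * (1 + δ * fR c r x)) +
     δ * ∑ k ∈ Finset.range (2^r), aS c r k *
    (1/2 * ((b (N + (2*k+1)) - b N) * Real.sin (((N + (2*k+1) : ℤ) : ℝ) * x) +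
      (-1) * ((b (N - (2*k+1)) - b N) * Real.sin (((N - (2*k+1) : ℤ) : ℝ) * x))))) := by
    have h1 := uS_eq_wS c r 1 δ x
    rw [uS, one_mul, wS, one_mul] at h1
    rw [h1, wS]
    congr 1
    rw [mul_add, add_assoc]
    congr 1
    · simp [hN]
    · rw [mul_left_comm, ← mul_add, Finset.mul_sum (a := b N), ← Finset.sum_add_distrib]
      congr 1
      refine Finset.sum_congr rfl fun k _ => ?_
      ring
  rw [e, abs_mul]
  refine mul_le_mul_of_nonneg_left ?_ (abs_nonneg _)
  refine (abs_add_le _ _).trans (add_le_add ?_ ?_)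
  · rw [abs_mul, mul_comm, abs_mul]
    refine mul_le_mul_of_nonneg_right ?_ (abs_nonneg _)
    have h1 := Real.abs_cos_le_one ((2:ℝ)^(2*r) * x)
    have h2 : |1 + δ * fR c r x| ≤ 3 := by
      have := abs_le.1 (hf x)
      rw [abs_le]; constructor <;> nlinarith
    calc _ ≤ 1 * (3:ℝ) := by gcongr
      _ = 3 := by ring
  · rw [abs_mul, abs_of_nonneg hδ]
    have : |∑ k ∈ Finset.range (2^r), aS c r k *
    (1/2 * ((b (N + (2*k+1)) - b N) * Real.sin (((N + (2*k+1) : ℤ) : ℝ) * x) +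
      (-1) * ((b (N - (2*k+1)) - b N) * Real.sin (((N - (2*k+1) : ℤ) : ℝ) * x))))| ≤ 2^r * D := by
      refine (Finset.abs_sum_le_sum_abs _ _).trans ?_
      refine (Finset.sum_le_sum (g := fun _ => D) ?_).trans (by simp)
      intro k hk
      obtain ⟨h1, h2⟩ := hb k (Finset.mem_range.1 hk)
      have hD : 0 ≤ D := (abs_nonneg _).trans h1
      have s1 := Real.abs_sin_le_one (((N + (2*k+1) : ℤ) : ℝ) * x)
      have s2 := Real.abs_sin_le_one (((N - (2*k+1) : ℤ) : ℝ) * x)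
      set S1 := Real.sin (((N + (2*k+1) : ℤ) : ℝ) * x)
      set S2 := Real.sin (((N - (2*k+1) : ℤ) : ℝ) * x)
      set B1 := b (N + (2*k+1)) - b N
      set B2 := b (N - (2*k+1)) - b N
      have p1 : |B1 * S1| ≤ D := by
        rw [abs_mul]; calc _ ≤ D * 1 := by gcongr
          _ = D := by ring
      have p2 : |B2 * S2| ≤ D := by
        rw [abs_mul]; calc _ ≤ D * 1 := by gcongr
          _ = D := by ring
      rw [abs_mul]
      have p3 : |1/2 * (B1 * S1 + (-1) * (B2 * S2))| ≤ D := by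
        rw [abs_le] at *; constructor <;> linarith
      calc _ ≤ 1 * D := by gcongr; exact aS_bd c r k
        _ = D := by ring
    have hD : 0 ≤ 2^r * D := (abs_nonneg _).trans this
    calc _ ≤ 1 * (2^r * D) := by gcongr
      _ = _ := by ring

lemma chi_lip (c : LPCutoff) : ∃ K : ℝ, 0 ≤ K ∧ ∀ x y, |c.χ x - c.χ y| ≤ K * |x - y| := by
  have hc : HasCompactSupport c.χ := by
    apply HasCompactSupport.intro (K := Set.Icc (-(4/3)) (4/3)) isCompact_Icc
    intro x hx
    by_contra h
    exact hx (Set.Ioo_subset_Icc_self (c.supp x h))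
  obtain ⟨K, hK⟩ := ContDiff.lipschitzWith_of_hasCompactSupport hc c.smooth (by simp)
  refine ⟨K, K.2, fun x y => ?_⟩
  have := hK.dist_le_mul x y
  simpa [Real.dist_eq] using this

lemma bMult_low (c : LPCutoff) (n k : ℕ) (η : ℤ) (hk : k < n) (h : (7/8:ℝ) * 2^n ≤ η) : bMult c k η = 0 := by
  have key : ∀ j : ℕ, j ≤ k → c.χ ((2:ℝ)^(-(j:ℤ)) * η) = 0 := by
    intro j hj
    apply c.zero_of_ge
    rw [abs_mul, abs_of_pos (by positivity : (0:ℝ) < (2:ℝ)^(-(j:ℤ))), zpow_neg, zpow_natCast]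
    rw [inv_mul_eq_div, le_div_iff₀ (by positivity)]
    have h1 : (2:ℝ)^(j+1) ≤ 2^n := pow_le_pow_right₀ (by norm_num) (by omega)
    rw [pow_succ] at h1
    have : (0:ℝ) < 2^j := by positivity
    have := le_abs_self (η:ℝ)
    linarith
  cases k with
  | zero => have := key 0 le_rfl; simpa [bMult] using this
  | succ k => rw [bMult_succ, key _ le_rfl, key k (by omega)]; ring

lemma bMult_high (c : LPCutoff) (n k : ℕ) (η : ℤ) (hk : n + 1 < k) (h0 : (0:ℝ) ≤ η)
    (h : (η:ℝ) ≤ (9/8:ℝ) * 2^n) : bMult c k η = 0 := by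
  have key : ∀ j : ℕ, n + 1 ≤ j → c.χ ((2:ℝ)^(-(j:ℤ)) * η) = 1 := by
    intro j hj
    apply c.eq_one
    have h1 : (2:ℝ)^(n+1) ≤ 2^j := pow_le_pow_right₀ (by norm_num) (by omega)
    rw [pow_succ] at h1
    have : (0:ℝ) < 2^j := by positivity
    rw [zpow_neg, zpow_natCast, inv_mul_eq_div]
    constructor
    · have : 0 ≤ (η:ℝ)/2^j := by positivity
      linarith
    · rw [div_le_iff₀ (by positivity)]; linarith
  cases k with
  | zero => omega
  | succ k => rw [bMult_succ, key _ (by omega), key k (by omega)]; ring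

lemma bMult_lip (c : LPCutoff) (K : ℝ) (hK : 0 ≤ K) (hL : ∀ x y, |c.χ x - c.χ y| ≤ K * |x - y|)
    (n k : ℕ) (hn : 1 ≤ n) (hk : n ≤ k) (η η' : ℤ) :
    |bMult c k η - bMult c k η'| ≤ 3 * K / 2^n * |(η:ℝ) - η'| := by
  cases k with
  | zero => omega
  | succ k =>
    have key : ∀ j : ℕ, |c.χ ((2:ℝ)^(-(j:ℤ)) * η) - c.χ ((2:ℝ)^(-(j:ℤ)) * η')| ≤
        K / 2^j * |(η:ℝ) - η'| := by
      intro j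
      refine (hL _ _).trans (le_of_eq ?_)
      rw [← mul_sub, abs_mul, abs_of_pos (by positivity : (0:ℝ) < (2:ℝ)^(-(j:ℤ))), zpow_neg, zpow_natCast]
      ring
    have h1 := key (k+1)
    have h2 := key k
    have e1 : K / 2^(k+1) ≤ K/2^n := by gcongr; norm_num
    have e2 : K / 2^k ≤ 2 * K/2^n := by
      have : K / 2^k = 2 * K/2^(k+1) := by rw [pow_succ]; field_simp
      rw [this]; gcongr; norm_num
    have h1' := h1.trans (mul_le_mul_of_nonneg_right e1 (abs_nonneg _))
    have h2' := h2.trans (mul_le_mul_of_nonneg_right e2 (abs_nonneg _))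
    rw [bMult_succ, bMult_succ]
    have e3 : 3 * K / 2^n * |(η:ℝ) - η'| = K/2^n * |(η:ℝ) - η'| + 2 * K/2^n * |(η:ℝ) - η'| := by ring
    rw [e3]
    rw [abs_le] at *
    constructor <;> linarith

lemma bMult_le_one (c : LPCutoff) (k : ℕ) (η : ℤ) : |bMult c k η| ≤ 1 := by
  have h0 := c.nonneg
  have h1 := c.le_one
  cases k with
  | zero => simp only [bMult, if_true]; rw [abs_of_nonneg (h0 _)]; exact h1 _
  | succ k =>
    rw [bMult_succ, abs_le]
    have := h0 ((2:ℝ)^(-((k+1:ℕ):ℤ)) * η)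
    have := h1 ((2:ℝ)^(-((k+1:ℕ):ℤ)) * η)
    have := h0 ((2:ℝ)^(-(k:ℤ)) * η)
    have := h1 ((2:ℝ)^(-(k:ℤ)) * η)
    constructor <;> linarith

lemma besov_init (c : LPCutoff) : ∃ C : ℝ, 0 ≤ C ∧ ∀ (r : ℕ) (c0 δ : ℝ), 4 ≤ r → 0 ≤ c0 → 0 ≤ δ → δ ≤ 1 →
    (∀ y, |fR c r y| ≤ 2) → besov1E c (toC (uS c r c0 δ)) ≤ ENNReal.ofReal (C * (2^(2*r) * c0)) := by
  obtain ⟨K, hK, hL⟩ := chi_lip c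
  refine ⟨2 * (3 + 6 * K), by positivity, ?_⟩
  intro r c0 δ hr hc0 hδ hδ1 hf
  have hr16 : (16:ℝ) ≤ 2^r := by
    calc (16:ℝ) = 2^4 := by norm_num
      _ ≤ 2^r := pow_le_pow_right₀ (by norm_num) hr
  have hNN : (2:ℝ)^(2*r) = 2^r * 2^r := by rw [two_mul, pow_add]
  have hξ : ∀ k : ℕ, k < 2^r → (2*(k:ℝ)+1) ≤ 2 * 2^r := by
    intro k hk
    have : (k:ℝ) + 1 ≤ 2^r := by exact_mod_cast hk
    linarith
  have hξ2 : ∀ k : ℕ, k < 2^r → (2*(k:ℝ)+1) ≤ 1/8 * 2^(2*r) := by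
    intro k hk
    have := hξ k hk
    rw [hNN]; nlinarith
  have blk : ∀ (k : ℕ) x, LPblock c ((k:ℤ)-1) (toC (uS c r c0 δ)) x = toC (wS c r c0 δ (bMult c k)) x :=
    fun k x => (uS_block c r k c0 δ).2 x
  have hz : ∀ k ∉ ({2*r, 2*r+1} : Finset ℕ),
      (2:ℝ≥0∞) ^ ((k:ℤ) - 1) * supNormE (LPblock c ((k:ℤ) - 1) (toC (uS c r c0 δ))) = 0 := by
    intro k hk
    have hb : ∀ η : ℤ, (7/8:ℝ) * 2^(2*r) ≤ η → (η:ℝ) ≤ 9/8 * 2^(2*r) → bMult c k η = 0 := by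
      intro η h1 h2
      have h0 : (0:ℝ) ≤ η := le_trans (by positivity) h1
      rcases lt_or_ge k (2*r) with h | h
      · exact bMult_low c _ k η h h1
      · refine bMult_high c (2*r) k η ?_ h0 h2
        simp at hk; omega
    have hpos : (0:ℝ) < 2^(2*r) := by positivity
    have b0 : bMult c k (2^(2*r)) = 0 := hb _ (by push_cast; linarith) (by push_cast; linarith)
    have : ∀ x, LPblock c ((k:ℤ) - 1) (toC (uS c r c0 δ)) x = 0 := by
      intro x
      rw [blk]
      have := wS_bd c r c0 δ hδ hδ1 (bMult c k) 0 hf (by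
        intro i hi
        have := hξ2 i hi
        have hi0 : (0:ℝ) ≤ i := by positivity
        rw [b0, hb (2^(2*r) + (2*i+1)) (by push_cast; linarith) (by push_cast; linarith),
          hb (2^(2*r) - (2*i+1)) (by push_cast; linarith) (by push_cast; linarith)]
        simp) x
      rw [b0] at this
      simp at this
      simp [toC, this]
    simp [supNormE, this]
  have hs : ∀ k ∈ ({2*r, 2*r+1} : Finset ℕ),
      (2:ℝ≥0∞) ^ ((k:ℤ) - 1) * supNormE (LPblock c ((k:ℤ) - 1) (toC (uS c r c0 δ))) ≤
      ENNReal.ofReal ((3 + 6 * K) * (2^(2*r) * c0)) := by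
    intro k hk
    have hk2 : 2*r ≤ k ∧ k ≤ 2*r+1 := by simp at hk; omega
    have h1 : (2:ℝ≥0∞) ^ ((k:ℤ) - 1) ≤ ENNReal.ofReal (2^(2*r)) := by
      rw [ENNReal.ofReal_pow (by norm_num)]
      rw [← zpow_natCast]
      simp only [ENNReal.ofReal_ofNat]
      apply ENNReal.zpow_le_of_le (by norm_num)
      push_cast; omega
    have h2 : supNormE (LPblock c ((k:ℤ) - 1) (toC (uS c r c0 δ))) ≤ ENNReal.ofReal (c0 * (3 + 6 * K)) := by
      refine iSup_le fun x => ?_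
      rw [blk]
      have h3 := wS_bd c r c0 δ hδ hδ1 (bMult c k) (3 * K / 2^(2*r) * (2 * 2^r)) hf (by
        intro i hi
        have hi2 := hξ i hi
        have hi0 : (0:ℝ) ≤ 2 * i + 1 := by positivity
        constructor
        · refine (bMult_lip c K hK hL (2*r) k (by omega) hk2.1 _ _).trans ?_
          gcongr
          push_cast
          rw [add_sub_cancel_left, abs_of_nonneg hi0]; exact hi2
        · refine (bMult_lip c K hK hL (2*r) k (by omega) hk2.1 _ _).trans ?_
          gcongr
          push_cast
          rw [sub_sub_cancel_left, abs_neg, abs_of_nonneg hi0]; exact hi2) x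
      have h4 : (2:ℝ)^r * (3 * K / 2^(2*r) * (2 * 2^r)) = 6 * K := by
        rw [hNN]; field_simp; ring
      rw [h4, abs_of_nonneg hc0] at h3
      have h5 : |wS c r c0 δ (bMult c k) x| ≤ c0 * (3 + 6 * K) := by
        refine h3.trans ?_
        have := bMult_le_one c k (2^(2*r))
        gcongr
        linarith
      rw [← ENNReal.ofReal_coe_nnreal]
      apply ENNReal.ofReal_le_ofReal
      simpa [toC] using h5
    calc _ ≤ ENNReal.ofReal (2^(2*r)) * ENNReal.ofReal (c0 * (3 + 6 * K)) := by gcongr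
      _ = _ := by rw [← ENNReal.ofReal_mul (by positivity)]; congr 1; ring
  rw [besov1E, tsum_eq_sum (s := {2*r, 2*r+1}) hz]
  refine (Finset.sum_le_sum hs).trans ?_
  rw [Finset.sum_const, ← ENNReal.ofReal_nsmul]
  apply ENNReal.ofReal_le_ofReal
  simp
  linarith


lemma fR_cont (c : LPCutoff) (r : ℕ) : Continuous (fR c r) :=
  continuous_iff_continuousAt.2 fun x => (fR_deriv c r x).continuousAt

lemma fR'_cont (c : LPCutoff) (r : ℕ) : Continuous (fR' c r) := by
  unfold fR'; fun_prop

lemma cosN_deriv (N x : ℝ) : HasDerivAt (fun y => Real.cos (N * y)) (-Real.sin (N * x) * N) x := by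
  have h1 : HasDerivAt (fun y : ℝ => N * y) N x := by simpa using (hasDerivAt_id x).const_mul N
  exact h1.cos

lemma sinN_deriv (N x : ℝ) : HasDerivAt (fun y => Real.sin (N * y)) (Real.cos (N * x) * N) x := by
  have h1 : HasDerivAt (fun y : ℝ => N * y) N x := by simpa using (hasDerivAt_id x).const_mul N
  exact h1.sin

lemma uS_deriv (c : LPCutoff) (r : ℕ) (a δ x : ℝ) : HasDerivAt (uS c r (a / 2^(2*r)) δ)
    (a * (-Real.sin ((2:ℝ)^(2*r) * x) * (1 + δ * fR c r x) +
      Real.cos ((2:ℝ)^(2*r) * x) * (δ * fR' c r x / 2^(2*r)))) x := by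
  have h := ((cosN_deriv ((2:ℝ)^(2*r)) x).const_mul (a / 2^(2*r))).mul
    (((fR_deriv c r x).const_mul δ).const_add 1)
  convert! h using 1
  field_simp

/-- the oscillating antiderivative -/
def gOsc (c : LPCutoff) (r : ℕ) (δ x : ℝ) : ℝ :=
  Real.sin ((2 * 2^(2*r)) * x) * (1 + δ * fR c r x)^2 / (4 * 2^(2*r))

def gOsc' (c : LPCutoff) (r : ℕ) (δ x : ℝ) : ℝ :=
  Real.cos ((2 * 2^(2*r)) * x) * (1 + δ * fR c r x)^2 / 2 +
    Real.sin ((2 * 2^(2*r)) * x) * (1 + δ * fR c r x) * (δ * fR' c r x / 2^(2*r)) / 2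

lemma gOsc_deriv (c : LPCutoff) (r : ℕ) (δ x : ℝ) : HasDerivAt (gOsc c r δ) (gOsc' c r δ x) x := by
  have h := ((sinN_deriv (2 * (2:ℝ)^(2*r)) x).mul
    ((((fR_deriv c r x).const_mul δ).const_add 1).pow 2)).div_const (4 * 2^(2*r))
  convert! h using 1
  unfold gOsc'
  simp only [Pi.pow_apply]
  field_simp
  push_cast
  ring

lemma rho_bd {δ f : ℝ} (hδ : 0 ≤ δ) (hδ1 : δ ≤ 1) (hf : |f| ≤ 2) : |1 + δ * f| ≤ 3 := by
  have := abs_le.1 hf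
  rw [abs_le]; constructor <;> nlinarith

lemma gOsc_bd (c : LPCutoff) (r : ℕ) (δ x : ℝ) (hδ : 0 ≤ δ) (hδ1 : δ ≤ 1) (hf : ∀ y, |fR c r y| ≤ 2) :
    |gOsc c r δ x| ≤ 9/4 / 2^(2*r) := by
  have h1 := rho_bd hδ hδ1 (hf x)
  have h2 := Real.abs_sin_le_one ((2 * 2^(2*r)) * x)
  rw [gOsc, abs_div, abs_mul, abs_pow, abs_of_pos (by positivity : (0:ℝ) < 4 * 2^(2*r))]
  calc _ ≤ 1 * 3^2 / (4 * (2:ℝ)^(2*r)) := by gcongr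
    _ = _ := by field_simp; norm_num

lemma alg_osc {s k ρ g X : ℝ} (hs : |s| ≤ 1) (hk : |k| ≤ 1) (hρ : |ρ| ≤ 3) (hg : |g| ≤ X) (hX1 : X ≤ 1) :
    |(-s * ρ + k * g)^2 + ((1 - 2*s^2) * ρ^2/2 + (2*s*k) * ρ * g/2) - ρ^2/2| ≤ 9 * X := by
  have hX : 0 ≤ X := (abs_nonneg _).trans hg
  have e : (-s * ρ + k * g)^2 + ((1 - 2*s^2) * ρ^2/2 + (2*s*k) * ρ * g/2) - ρ^2/2 = k * (g * (k * g) - s * ρ * g) := by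
    ring
  rw [e, abs_mul]
  have h1 : |g * (k * g)| ≤ X * (1 * X) := by rw [abs_mul, abs_mul]; gcongr
  have h2 : |s * ρ * g| ≤ 1 * 3 * X := by rw [abs_mul, abs_mul]; gcongr
  have h3 : |g * (k * g) - s * ρ * g| ≤ 9 * X := by
    have := abs_le.1 h1
    have := abs_le.1 h2
    rw [abs_le]; constructor <;> nlinarith
  calc _ ≤ 1 * (9 * X) := by gcongr
    _ = _ := by ring

lemma pt_osc (c : LPCutoff) (r : ℕ) (a δ x : ℝ) (hδ : 0 ≤ δ) (hδ1 : δ ≤ 1) (hf : ∀ y, |fR c r y| ≤ 2) :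
    |deriv (uS c r (a / 2^(2*r)) δ) x * deriv (uS c r (a / 2^(2*r)) δ) x + a^2 * gOsc' c r δ x
      - a^2 * ((1 + δ * fR c r x)^2/2)| ≤ a^2 * (9 / 2^r) := by
  rw [(uS_deriv c r a δ x).deriv]
  have hg : |δ * fR' c r x / 2^(2*r)| ≤ 1 / 2^r := by
    have := fR'_bd c r x
    rw [abs_div, abs_mul, abs_of_nonneg hδ, abs_of_pos (by positivity : (0:ℝ) < 2^(2*r)),
      two_mul, pow_add]
    calc _ ≤ 1 * (2:ℝ)^r / (2^r * 2^r) := by gcongr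
      _ = _ := by field_simp
  have h1 := alg_osc (Real.abs_sin_le_one ((2:ℝ)^(2*r) * x)) (Real.abs_cos_le_one ((2:ℝ)^(2*r) * x))
    (rho_bd hδ hδ1 (hf x)) hg (by rw [div_le_one (by positivity)]; exact one_le_pow₀ (by norm_num))
  have e : gOsc' c r δ x = (1 - 2 * Real.sin ((2:ℝ)^(2*r) * x)^2) * (1 + δ * fR c r x)^2/2 +
     (2 * Real.sin ((2:ℝ)^(2*r) * x) * Real.cos ((2:ℝ)^(2*r) * x)) * (1 + δ * fR c r x) * (δ * fR' c r x / 2^(2*r))/2 := by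
    rw [gOsc', show (2 * (2:ℝ)^(2*r)) * x = 2 * (2^(2*r) * x) by ring, Real.sin_two_mul, Real.cos_two_mul,
      Real.cos_sq']
    ring
  rw [e]
  set s := Real.sin ((2:ℝ)^(2*r) * x)
  set k := Real.cos ((2:ℝ)^(2*r) * x)
  set ρ := (1 + δ * fR c r x)
  set g := (δ * fR' c r x / 2^(2*r))
  have e2 : a * (-s * ρ + k * g) * (a * (-s * ρ + k * g)) + a^2 * ((1 - 2 * s^2) * ρ^2/2 + (2*s*k) * ρ * g/2)
    - a^2 * (ρ^2/2) = a^2 * ((-s * ρ + k * g)^2 + ((1 - 2*s^2) * ρ^2/2 + (2*s*k) * ρ * g/2) - ρ^2/2) := by ring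
  rw [e2, abs_mul, abs_of_nonneg (sq_nonneg a)]
  refine mul_le_mul_of_nonneg_left (h1.trans (le_of_eq (by ring))) (sq_nonneg a)

lemma int_osc (c : LPCutoff) (r : ℕ) (a δ : ℝ) {α β : ℝ} :
    (∫ y in α..β, (deriv (uS c r (a / 2^(2*r)) δ) y * deriv (uS c r (a / 2^(2*r)) δ) y + a^2 * gOsc' c r δ y))
    = (∫ y in α..β, deriv (uS c r (a / 2^(2*r)) δ) y * deriv (uS c r (a / 2^(2*r)) δ) y)
      + a^2 * (gOsc c r δ β - gOsc c r δ α) ∧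
    IntervalIntegrable (fun y => deriv (uS c r (a / 2^(2*r)) δ) y * deriv (uS c r (a / 2^(2*r)) δ) y + a^2 * gOsc' c r δ y) volume α β := by
  have c1 : Continuous (fun y => deriv (uS c r (a / 2^(2*r)) δ) y) := by
    have : (fun y => deriv (uS c r (a / 2^(2*r)) δ) y) = _ := funext fun x => (uS_deriv c r a δ x).deriv
    rw [this]
    have := fR_cont c r
    have := fR'_cont c r
    fun_prop
  have c2 : Continuous (gOsc' c r δ) := by
    have := fR_cont c r
    have := fR'_cont c r
    unfold gOsc'
    fun_prop
  have i1 : IntervalIntegrable (fun y => deriv (uS c r (a / 2^(2*r)) δ) y * deriv (uS c r (a / 2^(2*r)) δ) y) volume α β :=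
    (c1.mul c1).intervalIntegrable _ _
  have i2 : IntervalIntegrable (fun y => a^2 * gOsc' c r δ y) volume α β :=
    (continuous_const.mul c2).intervalIntegrable _ _
  refine ⟨?_, i1.add i2⟩
  rw [intervalIntegral.integral_add i1 i2, intervalIntegral.integral_const_mul,
    intervalIntegral.integral_eq_sub_of_hasDerivAt (fun x _ => gOsc_deriv c r δ x) (c2.intervalIntegrable _ _)]

lemma int_lower (c : LPCutoff) (r : ℕ) (a δ : ℝ) {α β : ℝ} (hαβ : α ≤ β) (hδ : 0 ≤ δ) (hδ1 : δ ≤ 1)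
    (hf : ∀ y, |fR c r y| ≤ 2) (hpos : ∀ y ∈ Set.Icc α β, 1/4 ≤ fR c r y) :
    a^2 * ((1/2 + δ/4 - 9/2^r) * (β - α) - 5/2^(2*r)) ≤
    ∫ y in α..β, deriv (uS c r (a / 2^(2*r)) δ) y * deriv (uS c r (a / 2^(2*r)) δ) y := by
  obtain ⟨h1, h2⟩ := int_osc c r a δ (α := α) (β := β)
  have h3 := intervalIntegral.integral_mono_on hαβ
    (intervalIntegrable_const (c := a^2 * (1/2 + δ/4 - 9/2^r))) h2 (by
      intro x hx
      have p := (abs_le.1 (pt_osc c r a δ x hδ hδ1 hf)).1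
      have q : 1/2 + δ/4 ≤ (1 + δ * fR c r x)^2/2 := by
        have := hpos x hx
        nlinarith [sq_nonneg (δ * fR c r x), mul_le_mul_of_nonneg_left this hδ]
      have := mul_le_mul_of_nonneg_left q (sq_nonneg a)
      linarith)
  rw [h1, intervalIntegral.integral_const, smul_eq_mul] at h3
  have g1 := abs_le.1 (gOsc_bd c r δ α hδ hδ1 hf)
  have g2 := abs_le.1 (gOsc_bd c r δ β hδ hδ1 hf)
  have g3 : gOsc c r δ β - gOsc c r δ α ≤ 5/2^(2*r) := by
    have : (0:ℝ) < 1/2^(2*r) := by positivity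
    have e1 : (9:ℝ)/4/2^(2*r) = 9/4 * (1/2^(2*r)) := by ring
    have e2 : (5:ℝ)/2^(2*r) = 5 * (1/2^(2*r)) := by ring
    rw [e1] at g1 g2; rw [e2]; linarith
  have := mul_le_mul_of_nonneg_left g3 (sq_nonneg a)
  linarith

lemma int_upper (c : LPCutoff) (r : ℕ) (a δ : ℝ) {α β : ℝ} (hαβ : α ≤ β) (hδ : 0 ≤ δ) (hδ1 : δ ≤ 1)
    (hf : ∀ y, |fR c r y| ≤ 2) (hpos : ∀ y ∈ Set.Icc α β, fR c r y ≤ -(1/4)) :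
    (∫ y in α..β, deriv (uS c r (a / 2^(2*r)) δ) y * deriv (uS c r (a / 2^(2*r)) δ) y) ≤
    a^2 * ((1/2 - δ/4 + 2 * δ^2 + 9/2^r) * (β - α) + 5/2^(2*r)) := by
  obtain ⟨h1, h2⟩ := int_osc c r a δ (α := α) (β := β)
  have h3 := intervalIntegral.integral_mono_on hαβ h2
    (intervalIntegrable_const (c := a^2 * (1/2 - δ/4 + 2 * δ^2 + 9/2^r))) (by
      intro x hx
      have p := (abs_le.1 (pt_osc c r a δ x hδ hδ1 hf)).2
      have q : (1 + δ * fR c r x)^2/2 ≤ 1/2 - δ/4 + 2 * δ^2 := by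
        have := hpos x hx
        have h4 : (fR c r x)^2 ≤ 4 := by
          have := abs_le.1 (hf x); nlinarith
        nlinarith [mul_le_mul_of_nonneg_left h4 (sq_nonneg δ), mul_le_mul_of_nonneg_left this hδ]
      have := mul_le_mul_of_nonneg_left q (sq_nonneg a)
      linarith)
  rw [h1, intervalIntegral.integral_const, smul_eq_mul] at h3
  have g1 := abs_le.1 (gOsc_bd c r δ α hδ hδ1 hf)
  have g2 := abs_le.1 (gOsc_bd c r δ β hδ hδ1 hf)
  have g3 : -(5/2^(2*r)) ≤ gOsc c r δ β - gOsc c r δ α := by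
    have : (0:ℝ) < 1/2^(2*r) := by positivity
    have e1 : (9:ℝ)/4/2^(2*r) = 9/4 * (1/2^(2*r)) := by ring
    have e2 : (5:ℝ)/2^(2*r) = 5 * (1/2^(2*r)) := by ring
    rw [e1] at g1 g2; rw [e2]; linarith
  have := mul_le_mul_of_nonneg_left g3 (sq_nonneg a)
  linarith

lemma br_alg {δ h i l0 ℓ1 ℓ2 : ℝ} (hδ : 0 < δ) (hδ1 : δ ≤ 1/21) (hh : 0 < h) (hi0 : 0 < i)
    (hii : i * i ≤ i * h/19) (hih : i * h ≤ δ * h / 1036)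
    (hℓ1a : -(h/7) ≤ ℓ1 - h) (hℓ1b : ℓ1 - h ≤ h/7) (hℓ2a : -(h/7) ≤ ℓ2 - h) (hℓ2b : ℓ2 - h ≤ h/7)
    (hl0 : l0 = ℓ1 - ℓ2) :
    δ * h / 4 - |l0|/2 ≤ ((1/2 + δ/4 - 9*i) * ℓ1 - 5*(i*i)) - ((1/2 - δ/4 + 2 * δ^2 + 9*i) * ℓ2 + 5*(i*i)) := by
  have hab := neg_abs_le l0
  have q1 : δ * (12/7 * h) ≤ δ * (ℓ1 + ℓ2) := mul_le_mul_of_nonneg_left (by linarith) hδ.le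
  have q2 : i * (ℓ1 + ℓ2) ≤ i * (16/7 * h) := mul_le_mul_of_nonneg_left (by linarith) hi0.le
  have q3 : δ^2 * ℓ2 ≤ δ/21 * (8/7 * h) := by
    have : δ^2 ≤ δ/21 := by nlinarith
    have h0 : 0 ≤ ℓ2 := by linarith
    exact mul_le_mul this (by linarith) h0 (by positivity)
  have : 0 ≤ δ * h := by positivity
  have e : ((1/2 + δ/4 - 9*i) * ℓ1 - 5*(i*i)) - ((1/2 - δ/4 + 2 * δ^2 + 9*i) * ℓ2 + 5*(i*i)) =
    (ℓ1 - ℓ2)/2 + (δ * (ℓ1 + ℓ2))/4 - 9 * (i * (ℓ1 + ℓ2)) - 2 * (δ^2 * ℓ2) - 10 * (i * i) := by ring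
  rw [e, ← hl0]
  generalize i * (ℓ1 + ℓ2) = A at *
  generalize δ * (ℓ1 + ℓ2) = B at *
  generalize δ^2 * ℓ2 = C at *
  linarith

lemma final_alg {a δ T Λ R h l0 l1 l2 ℓ1 ℓ2 F I1 I2 : ℝ}
    (ha0 : 0 < a) (ha : a ≤ 1) (hδ : 0 < δ) (hδ1 : δ ≤ 1/21) (hR : 1036 ≤ δ * R) (hR0 : 0 < R) (hT0 : 0 < T)
    (hT : T ≤ 1) (hΛ : 0 ≤ Λ) (hh : 0 < h) (hRh : 19 ≤ R * h)
    (hE : 36/R + 15 * Λ * h ≤ 1/40 * (T * a^2 * δ))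
    (hℓ1 : |ℓ1 - h| ≤ h/7) (hℓ2 : |ℓ2 - h| ≤ h/7)
    (hl0 : l0 = ℓ1 - ℓ2) (hl1 : |l1| ≤ 12 * (a/(R * R))) (hl2 : l2 = I1 - I2)
    (hI1 : a^2 * ((1/2 + δ/4 - 9/R) * ℓ1 - 5/(R*R)) ≤ I1)
    (hI2 : I2 ≤ a^2 * ((1/2 - δ/4 + 2 * δ^2 + 9/R) * ℓ2 + 5/(R*R)))
    (hF : F ≥ (1/2)*T*l2-(1/8)*T*|l2|-2*|l1|-12*Λ*h^2)
    (hl0' : |l0| ≤ T*(2*|l1|+T*|l2|+12*Λ*h^2)) :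
    F ≥ 1/40 * (T * a^2 * δ) * h := by
  have hRinv : 1/R ≤ h/19 := by rw [div_le_div_iff₀ hR0 (by norm_num)]; linarith
  set i := 1/R with hi
  have hi0 : 0 < i := by positivity
  have hiR : i * R = 1 := by rw [hi]; field_simp
  have e1 : 9/R = 9 * i := by rw [hi]; ring
  have e2 : 5/(R*R) = 5 * (i*i) := by rw [hi]; field_simp
  have e3 : a/(R*R) = a * (i*i) := by rw [hi]; field_simp
  have e4 : 36/R = 36 * i := by rw [hi]; ring
  rw [e1, e2] at hI1 hI2
  rw [e3] at hl1
  rw [e4] at hE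
  have hiδ : 1036 * i ≤ δ := by
    calc 1036 * i ≤ δ * R * i := by gcongr
      _ = δ * (i * R) := by ring
      _ = δ := by rw [hiR, mul_one]
  obtain ⟨hℓ1a, hℓ1b⟩ := abs_le.1 hℓ1
  obtain ⟨hℓ2a, hℓ2b⟩ := abs_le.1 hℓ2
  have hii : i * i ≤ i * h/19 := by
    calc i * i ≤ i * (h/19) := by gcongr
      _ = _ := by ring
  have hih : i * h ≤ δ * h / 1036 := by
    have := mul_le_mul_of_nonneg_right hiδ hh.le
    linarith
  -- bracket
  have br := br_alg (l0 := l0) hδ hδ1 hh hi0 hii hih hℓ1a hℓ1b hℓ2a hℓ2b hl0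
  have A2 : l2 ≥ a^2 * (δ * h/4 - |l0|/2) := by
    have := mul_le_mul_of_nonneg_left br (sq_nonneg a)
    rw [hl2]; linarith
  have a2le : a^2 ≤ 1 := pow_le_one₀ ha0.le ha
  clear br hI1 hI2 hℓ1 hℓ2 hℓ1a hℓ1b hℓ2a hℓ2b hl0 hl2 hδ1 hR hRh hRinv
  have a2pos : 0 < a^2 := by positivity
  have l1b : |l1| ≤ 12 * (i * h) / 19 := by
    have : a * (i*i) ≤ 1 * (i*i) := by gcongr
    linarith
  have hl1n := abs_nonneg l1
  set X := T * a^2 * δ * h with hX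
  have hE' : 36 * (i * h) + 15 * Λ * h^2 ≤ 1/40 * X := by
    have := mul_le_mul_of_nonneg_right hE hh.le
    rw [hX]; linarith
  have hXpos : 0 < X := by positivity
  have hXle : X ≤ a^2 * δ * h := by
    rw [hX]
    have : T * (a^2 * δ * h) ≤ 1 * (a^2 * δ * h) := by gcongr
    linarith
  have hΛh : 0 ≤ Λ * h^2 := by positivity
  have hl0b : |l0| ≤ 2*|l1| + 12*Λ*h^2 + T^2 * |l2| := by
    have e : T*(2*|l1|+T*|l2|+12*Λ*h^2) = T*(2*|l1|+12*Λ*h^2) + T^2 * |l2| := by ring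
    rw [e] at hl0'
    have : T*(2*|l1|+12*Λ*h^2) ≤ 1 * (2*|l1|+12*Λ*h^2) :=
      mul_le_mul_of_nonneg_right hT (by linarith)
    linarith
  have T2 : T^2 ≤ 1 := pow_le_one₀ hT0.le hT
  have key : l2 + |l2|/2 ≥ a^2 * δ * h/4 - |l1| - 6 * Λ * h^2 := by
    have h1 : a^2 * |l0| ≤ 2*|l1| + 12*Λ*h^2 + |l2| := by
      calc a^2 * |l0| ≤ 1 * |l0| := by gcongr
        _ ≤ 2*|l1| + 12*Λ*h^2 + T^2 * |l2| := by linarith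
        _ ≤ 2*|l1| + 12*Λ*h^2 + 1 * |l2| := by gcongr
        _ = _ := by ring
    linarith
  have ihpos : 0 < i * h := by positivity
  have l2pos : 0 < l2 := by
    by_contra hneg
    push Not at hneg
    rw [abs_of_nonpos hneg] at key
    linarith
  rw [abs_of_pos l2pos] at key hF
  have hTl2 : T * l2 ≥ T * (a^2 * δ * h/6) - |l1| - 4 * Λ * h^2 := by
    have h1 : l2 ≥ a^2 * δ * h/6 - 2/3 * |l1| - 4 * Λ * h^2 := by linarith
    have h2 := mul_le_mul_of_nonneg_left h1 hT0.le
    have h3 : T * (2/3 * |l1| + 4 * Λ * h^2) ≤ 1 * (2/3 * |l1| + 4 * Λ * h^2) := by gcongr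
    linarith
  have e5 : T * (a^2 * δ * h/6) = X/6 := by rw [hX]; ring
  rw [e5] at hTl2
  have e6 : 1/40 * (T * a^2 * δ) * h = 1/40 * X := by rw [hX]; ring
  rw [e6]
  linarith

lemma uS_sup (c : LPCutoff) (r : ℕ) (a δ x : ℝ) (ha : 0 ≤ a) (hδ : 0 ≤ δ) (hδ1 : δ ≤ 1) (hf : ∀ y, |fR c r y| ≤ 2) :
    |uS c r (a / 2^(2*r)) δ x| ≤ 3 * (a/(2^r*2^r)) := by
  have h1 := rho_bd hδ hδ1 (hf x)
  have h2 := Real.abs_cos_le_one ((2:ℝ)^(2*r) * x)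
  rw [uS, abs_mul, abs_mul, abs_of_nonneg (by positivity : 0 ≤ a / (2:ℝ)^(2*r)), two_mul r, pow_add]
  rw [two_mul r, pow_add] at h2
  calc _ ≤ a/(2^r*2^r) * 1 * 3 := by gcongr
    _ = _ := by ring

lemma one_scale (c : LPCutoff) (r : ℕ) {u : ℝ → ℝ → ℝ} {a δ T Λ : ℝ}
    (hf : ∀ y, |fR c r y| ≤ 2)
    (hf2 : ∀ y, 0 < y → y ≤ Real.pi / 2 → 16 ≤ 2^r * y → 1/4 ≤ fR c r y)
    (ha0 : 0 < a) (ha : a ≤ 1) (hδ : 0 < δ) (hδ1 : δ ≤ 1/21) (hR : 1036 ≤ δ * 2^r) (hT0 : 0 < T)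
    (hT : T ≤ 1) (hΛ : 0 ≤ Λ) (hΛT : Λ * T ≤ 1/8) (hs : IsCHSolution T u)
    (hu0 : u 0 = uS c r (a / 2^(2*r)) δ)
    (hb : ∀ t ∈ Set.Icc 0 T, ∀ x, |u t x| ≤ Λ ∧ |deriv (u t) x| ≤ Λ) :
    ∃ q, ∀ h, 0 < h → h ≤ 1/2 → 19 ≤ 2^r * h → 36/2^r + 15 * Λ * h ≤ 1/40 * (T * a^2 * δ) →
      fourPt (u T) q h ≥ 1/40 * (T * a^2 * δ) * h := by
  obtain ⟨q, hq⟩ := ch_key hT0.le hΛ hΛT hs hb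
  refine ⟨q, fun h hh hh2 hRh hE => ?_⟩
  obtain ⟨y1, y2, z1, z2, hy1, hy2, hz1, hz2, hk⟩ := hq h hh
  obtain ⟨k1, k2⟩ := hk _ _ _ rfl rfl rfl
  rw [hu0] at k1 k2
  have hδ1' : δ ≤ 1 := by linarith
  have a1 := abs_le.1 hy1
  have a2 := abs_le.1 hy2
  have a3 := abs_le.1 hz1
  have a4 := abs_le.1 hz2
  have hπ := Real.pi_gt_three
  have P1 : ∀ y ∈ Set.Icc y1 y2, 1/4 ≤ fR c r y := by
    intro y hy
    refine hf2 y (by linarith [hy.1]) (by linarith [hy.2]) ?_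
    have : 2^r * (6/7 * h) ≤ 2^r * y := by gcongr; linarith [hy.1]
    linarith
  have P2 : ∀ y ∈ Set.Icc z2 z1, fR c r y ≤ -(1/4) := by
    intro y hy
    have := hf2 (-y) (by linarith [hy.2]) (by linarith [hy.1]) (by
      have : 2^r * (6/7 * h) ≤ 2^r * (-y) := by gcongr; linarith [hy.2]
      linarith)
    rw [fR_neg] at this
    linarith
  have I1 := int_lower c r a δ (show y1 ≤ y2 by linarith) hδ.le hδ1' hf P1
  have I2 := int_upper c r a δ (show z2 ≤ z1 by linarith) hδ.le hδ1' hf P2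
  have hRR : (2:ℝ)^(2*r) = 2^r * 2^r := by rw [two_mul, pow_add]
  have eR : (5:ℝ)/2^(2*r) = 5/(2^r*2^r) := by rw [hRR]
  rw [eR] at I1 I2
  have s1 := abs_le.1 (uS_sup c r a δ y1 ha0.le hδ.le hδ1' hf)
  have s2 := abs_le.1 (uS_sup c r a δ y2 ha0.le hδ.le hδ1' hf)
  have s3 := abs_le.1 (uS_sup c r a δ z1 ha0.le hδ.le hδ1' hf)
  have s4 := abs_le.1 (uS_sup c r a δ z2 ha0.le hδ.le hδ1' hf)
  refine final_alg ha0 ha hδ hδ1 hR (by positivity) hT0 hT hΛ hh hRh hE hy2 hz2 rfl ?_ rfl I1 I2 k1 k2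
  rw [abs_le]; constructor <;> linarith


lemma asymp_x (C : ℝ) (hC : 0 ≤ C) : ∀ᶠ x : ℝ in atTop, 1 < x ∧ 1 ≤ Real.log x ∧
    1 ≤ Real.log (Real.log x) ∧ Real.log (Real.log x) ≤ Real.log x ∧ Real.log x ≤ x ∧
    x^(-(2:ℝ)/5) * Real.log x ≤ 1 ∧ x^(-(1:ℝ)/5) ≤ 1/21 ∧
    C * (x^(-(2:ℝ)/5) * Real.log x) ≤ 1 / Real.log (Real.log x) ∧
    6 * Real.log (Real.log x) * (1 / Real.log x) ≤ 1/8 ∧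
    129 * Real.log (Real.log x) < Real.log x / 320 ∧ 1/x ≤ x^(-(1:ℝ)/5) := by
  have hlog := Real.tendsto_log_atTop
  have hll := hlog.comp hlog
  have e1 : ∀ᶠ x : ℝ in atTop, Real.log x ≤ 1 * x^((1:ℝ)/10) := by
    have := (isLittleO_log_rpow_atTop (by norm_num : (0:ℝ) < 1/10)).bound (by norm_num : (0:ℝ) < 1)
    filter_upwards [this, eventually_gt_atTop 0] with x hx h0
    rw [Real.norm_eq_abs, Real.norm_eq_abs, abs_of_nonneg (Real.rpow_nonneg h0.le _)] at hx
    exact (le_abs_self _).trans hx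
  have e2 : ∀ᶠ x : ℝ in atTop, Real.log (Real.log x) ≤ 1/100000 * Real.log x := by
    have := (Real.isLittleO_log_id_atTop.comp_tendsto hlog).bound (by norm_num : (0:ℝ) < 1/100000)
    filter_upwards [this, hlog.eventually_ge_atTop 1] with x hx h0
    simp only [Function.comp, id, Real.norm_eq_abs] at hx
    rw [abs_of_nonneg (by linarith : 0 ≤ Real.log x)] at hx
    exact (le_abs_self _).trans hx
  have e3 : Tendsto (fun x : ℝ => x^(-((1:ℝ)/5))) atTop (nhds 0) := tendsto_rpow_neg_atTop (by norm_num)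
  have e4 := e3.eventually_le_const (show (0:ℝ) < 1/21 by norm_num)
  have e5 := e3.eventually_le_const (show (0:ℝ) < 1/(C+1) by positivity)
  filter_upwards [e1, e2, e4, e5, eventually_gt_atTop 1, hlog.eventually_ge_atTop 1,
    hll.eventually_ge_atTop 1] with x h1 h2 h4 h5 hx hl1 hl2
  simp only [Function.comp] at hl2
  have hx0 : 0 < x := by linarith
  set y := Real.log x
  set z := Real.log y
  rw [one_mul] at h1
  have p : x^(-(2:ℝ)/5) * (x^((1:ℝ)/10) * x^((1:ℝ)/10)) = x^(-((1:ℝ)/5)) := by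
    rw [← Real.rpow_add hx0, ← Real.rpow_add hx0]; norm_num
  have hpos : 0 < x^(-(2:ℝ)/5) := Real.rpow_pos_of_pos hx0 _
  have hzy : z ≤ y := by linarith
  have q : x^(-(2:ℝ)/5) * (y * z) ≤ x^(-((1:ℝ)/5)) := by
    rw [← p]; gcongr; exact hzy.trans h1
  have q' : x^(-(2:ℝ)/5) * y ≤ x^(-((1:ℝ)/5)) := by
    refine le_trans ?_ q
    gcongr
    nlinarith
  have e6 : (-(1:ℝ)/5) = -(1/5) := by norm_num
  refine ⟨hx, hl1, hl2, hzy, ?_, by linarith, by rw [e6]; exact h4, ?_, ?_, by linarith, ?_⟩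
  · exact (Real.log_le_sub_one_of_pos hx0).trans (by linarith)
  · rw [le_div_iff₀ (by linarith)]
    calc C * (x^(-(2:ℝ)/5) * y) * z = C * (x^(-(2:ℝ)/5) * (y * z)) := by ring
      _ ≤ C * (1/(C+1)) := by gcongr; exact q.trans h5
      _ ≤ 1 := by rw [mul_one_div, div_le_one (by positivity)]; linarith
  · rw [mul_one_div, div_le_iff₀ (by linarith)]; linarith
  · rw [one_div, ← Real.rpow_neg_one]
    exact Real.rpow_le_rpow_of_exponent_le hx.le (by norm_num)

lemma asymp_j : ∀ᶠ j : ℕ in atTop, 1290240 * (j:ℝ)^2 ≤ 4^j := by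
  have := tendsto_pow_const_div_const_pow_of_one_lt 2 (by norm_num : (1:ℝ) < 4)
  filter_upwards [this.eventually_le_const (show (0:ℝ) < 1/1290240 by norm_num)] with j hj
  rw [div_le_div_iff₀ (by positivity) (by norm_num)] at hj
  linarith

lemma asymp_all (C : ℝ) (hC : 0 ≤ C) (r0 : ℕ) : ∃ J : ℕ, ∀ j ≥ J, ∀ x : ℝ, x = ((16 * j : ℕ) : ℝ) →
    (2 ≤ j ∧ r0 ≤ 8 * j ∧ 1290240 * (j:ℝ)^2 ≤ 4^j) ∧ 1 < x ∧ 1 ≤ Real.log x ∧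
    1 ≤ Real.log (Real.log x) ∧ Real.log (Real.log x) ≤ Real.log x ∧ Real.log x ≤ x ∧
    x^(-(2:ℝ)/5) * Real.log x ≤ 1 ∧ x^(-(1:ℝ)/5) ≤ 1/21 ∧
    C * (x^(-(2:ℝ)/5) * Real.log x) ≤ 1 / Real.log (Real.log x) ∧
    6 * Real.log (Real.log x) * (1 / Real.log x) ≤ 1/8 ∧
    129 * Real.log (Real.log x) < Real.log x / 320 ∧ 1/x ≤ x^(-(1:ℝ)/5) := by
  have ht : Tendsto (fun j : ℕ => ((16 * j : ℕ) : ℝ)) atTop atTop :=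
    tendsto_natCast_atTop_atTop.comp (tendsto_id.const_mul_atTop' (by norm_num))
  have := (ht.eventually (asymp_x C hC)).and (asymp_j.and
    ((eventually_ge_atTop 2).and (eventually_ge_atTop r0)))
  obtain ⟨J, hJ⟩ := eventually_atTop.1 this
  refine ⟨J, fun j hj x hx => ?_⟩
  obtain ⟨h1, h2, h3, h4⟩ := hJ j hj
  rw [hx]
  exact ⟨⟨h3, by omega, h2⟩, h1⟩

lemma u0_eq (c : LPCutoff) (j : ℕ) : u0CH c (16 * j) = uS c (8 * j)
    (((16 * j : ℕ):ℝ)^(-(2:ℝ)/5) * Real.log ((16 * j : ℕ):ℝ) / 2^(2*(8*j)))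
    (((16 * j : ℕ):ℝ)^(-(1:ℝ)/5)) := by
  funext x
  have e : 16 * j = 2 * (8 * j) := by ring
  unfold u0CH uS
  have : fLow c (16 * j) = fR c (8 * j) := by rw [e, fLow_eq]
  rw [this]
  congr 1
  rw [zpow_neg, zpow_natCast]
  rw [show 2 * (8 * j) = 16 * j by ring]
  congr 1
  field_simp

theorem CH_norm_inflation_proof (c : LPCutoff) :
    ∃ N : ℕ, ∀ n : ℕ, 16 ∣ n → N ≤ n →
      besov1E c (toC (u0CH c n)) ≤ ENNReal.ofReal (1 / Real.log (Real.log n)) ∧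
      ∀ u : ℝ → ℝ → ℝ, IsCHSolution (1 / Real.log n) u → (∀ x, u 0 x = u0CH c n x) →
        ∃ t₀ ∈ Set.Ioc (0:ℝ) (1 / Real.log n),
          ENNReal.ofReal (Real.log (Real.log n)) ≤ besov1E c (toC (u t₀)) := by
  obtain ⟨C, hC, hinit⟩ := besov_init c
  obtain ⟨r0, hfR⟩ := fR_facts c
  obtain ⟨J, hJ⟩ := asymp_all C hC r0
  refine ⟨16 * J, ?_⟩
  rintro n ⟨j, rfl⟩ hn
  obtain ⟨⟨hj2, hjr, hj4⟩, hx1, hl1, hll1, hlll, hlx, ha1, hδ1, hCa, hΛT, h129, hδx⟩ :=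
    hJ j (by omega) _ rfl
  obtain ⟨hf, hf2⟩ := hfR (8*j) hjr
  have hueq := u0_eq c j
  set x : ℝ := ((16 * j : ℕ) : ℝ) with hx
  have hx16 : x = 16 * j := by rw [hx]; push_cast; ring
  set L := Real.log (Real.log x) with hL
  set a := x^(-(2:ℝ)/5) * Real.log x with ha
  set δ := x^(-(1:ℝ)/5) with hδ
  have hx0 : 0 < x := by linarith
  have ha0 : 0 < a := mul_pos (Real.rpow_pos_of_pos hx0 _) (by linarith)
  have hδ0 : 0 < δ := Real.rpow_pos_of_pos hx0 _
  set T := 1 / Real.log x with hT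
  have hT0 : 0 < T := by positivity
  have hT1 : T ≤ 1 := by rw [hT, div_le_one (by linarith)]; exact hl1
  have hinit1 : besov1E c (toC (u0CH c (16 * j))) ≤ ENNReal.ofReal (1 / L) := by
    rw [hueq]
    refine (hinit (8*j) _ δ (by omega) (by positivity) hδ0.le (by linarith) hf).trans ?_
    apply ENNReal.ofReal_le_ofReal
    rw [mul_div_cancel₀ _ (by positivity)]
    exact hCa
  refine ⟨hinit1, ?_⟩
  intro u hs hu0
  by_contra hcon
  push Not at hcon
  have hu0' : u 0 = u0CH c (16 * j) := funext hu0
  have hBL : ∀ t ∈ Set.Icc 0 T, besov1E c (toC (u t)) ≤ ENNReal.ofReal L := by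
    intro t ht
    rcases ht.1.eq_or_lt with h | h
    · rw [← h, hu0']
      refine hinit1.trans (ENNReal.ofReal_le_ofReal ?_)
      rw [div_le_iff₀ (by linarith)]; nlinarith
    · exact (hcon t ⟨h, ht.2⟩).le
  have hL0 : 0 ≤ L := by linarith
  have hsm : ∀ t, ContDiff ℝ 2 (u t) := by
    intro t
    have h1 : ContDiff ℝ (⊤ : ℕ∞) (fun y : ℝ => Function.uncurry u (t, y)) :=
      hs.1.comp (contDiff_const.prodMk contDiff_id)
    exact_mod_cast contDiff_infty.1 h1 2
  have hb : ∀ t ∈ Set.Icc 0 T, ∀ y, |u t y| ≤ 6 * L ∧ |deriv (u t) y| ≤ 6 * L := by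
    intro t ht y
    obtain ⟨h1, h2, _⟩ := besov_cons_real c (u t) (hsm t) (hs.2.1 t) L hL0 (hBL t ht)
    exact ⟨(h1 y).trans (by linarith), h2 y⟩
  have hTad : T * a^2 * δ = Real.log x / x := by
    have e1 : (x^(-(2:ℝ)/5))^2 * x^(-(1:ℝ)/5) = 1/x := by
      rw [← Real.rpow_natCast, ← Real.rpow_mul hx0.le, ← Real.rpow_add hx0, one_div, ← Real.rpow_neg_one]
      norm_num
    have hlne : Real.log x ≠ 0 := by linarith
    calc T * a^2 * δ = (T * Real.log x) * Real.log x * ((x^(-(2:ℝ)/5))^2 * x^(-(1:ℝ)/5)) := by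
          rw [ha, hδ]; ring
      _ = _ := by rw [e1, hT]; field_simp
  have hjpos : (2:ℝ) ≤ j := by exact_mod_cast hj2
  have h256 : (2:ℝ)^(8*j) = 256^j := by rw [pow_mul]; norm_num
  have h4le : (4:ℝ)^j ≤ 2^(8*j) := by rw [h256]; gcongr; norm_num
  have hR : 1036 ≤ δ * 2^(8*j) := by
    have h1 : 1036 * x ≤ 2^(8*j) := by
      rw [hx16]; nlinarith
    calc (1036:ℝ) = 1/x * (1036 * x) := by field_simp
      _ ≤ δ * 2^(8*j) := by gcongr
  obtain ⟨q, hq⟩ := one_scale c (8*j) hf hf2 ha0 ha1 hδ0 hδ1 hR hT0 hT1 (by linarith : 0 ≤ 6 * L)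
    hΛT hs (hu0'.trans hueq) hb
  obtain ⟨_, _, h3⟩ := besov_cons_real c (u T) (hsm T) (hs.2.1 T) L hL0 (hBL T ⟨hT0.le, le_rfl⟩)
  have h4 := h3 (4*j) q
  have hm : ∀ m ∈ Finset.Ico (2*j) (4*j), 1/40 * (Real.log x / x) ≤ 2^m * |fourPt (u T) q (1/2^m)| := by
    intro m hm
    rw [Finset.mem_Ico] at hm
    have b1 : (4:ℝ)^j ≤ 2^m := by
      calc (4:ℝ)^j = 2^(2*j) := by rw [pow_mul]; norm_num
        _ ≤ 2^m := pow_le_pow_right₀ (by norm_num) hm.1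
    have h16 : (16:ℝ) ≤ 4^j := by nlinarith
    have b2 : (2:ℝ)^m * 256 ≤ 2^(8*j) := by
      calc (2:ℝ)^m * 256 = 2^(m+8) := by rw [pow_add]; norm_num
        _ ≤ 2^(8*j) := pow_le_pow_right₀ (by norm_num) (by omega)
    have hmp : (0:ℝ) < 2^m := by positivity
    have := hq (1/2^m) (by positivity)
      (by rw [div_le_div_iff₀ hmp (by norm_num)]; linarith)
      (by rw [mul_one_div, le_div_iff₀ hmp]; linarith)
      (by
        rw [hTad]
        have i1 : 36/(2:ℝ)^(8*j) ≤ 36/4^j := by gcongr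
        have i2 : 15 * (6 * L) * (1/2^m) ≤ 15 * (6 * L) * (1/4^j) := by gcongr
        have i3 : 36/(4:ℝ)^j + 15 * (6*L) * (1/4^j) = (36 + 90 * L)/4^j := by ring
        have i4 : (36 + 90 * L)/(4:ℝ)^j ≤ 1/40 * (1/x) := by
          rw [div_le_iff₀ (by positivity)]
          have : 36 + 90 * L ≤ 126 * x := by linarith
          refine this.trans ?_
          rw [one_div_mul_one_div, one_div_mul_eq_div, le_div_iff₀ (by positivity), hx16]
          linarith
        have i5 : 1/x ≤ Real.log x / x := by gcongr
        linarith)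
    rw [hTad] at this
    have h5 := this.le.trans (le_abs_self _)
    calc 1/40 * (Real.log x / x) = 2^m * (1/40 * (Real.log x / x) * (1/2^m)) := by field_simp
      _ ≤ _ := by gcongr
  have h5 : ∑ m ∈ Finset.Ico (2*j) (4*j), (2:ℝ)^m * |fourPt (u T) q (1/2^m)| ≤
      ∑ m ∈ Finset.range (4*j), (2:ℝ)^m * |fourPt (u T) q (1/2^m)| := by
    apply Finset.sum_le_sum_of_subset_of_nonneg
    · intro m hm
      rw [Finset.mem_Ico] at hm; rw [Finset.mem_range]; exact hm.2
    · intros; positivity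
  have h6 := Finset.card_nsmul_le_sum _ _ _ hm
  rw [Nat.card_Ico, show 4 * j - 2 * j = 2 * j by omega, nsmul_eq_mul] at h6
  have h7 : ((2 * j : ℕ):ℝ) * (1/40 * (Real.log x / x)) = Real.log x / 320 := by
    push_cast
    have : (j:ℝ) = x / 16 := by rw [hx16]; ring
    rw [this]; field_simp; norm_num
  linarith

/-- Norm inflation for the periodic Camassa–Holm equation in `B^1_{∞,1}(𝕋)`:
for all sufficiently large `n ∈ 16ℕ`, `‖u_{0,n}‖_{B^1_{∞,1}} ≤ 1/(log log n)`, while any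
smooth solution on `[0, 1/log n]` with data `u_{0,n}` satisfies
`‖u(t₀)‖_{B^1_{∞,1}} ≥ log log n` for some `t₀ ∈ (0, 1/log n]`. -/
theorem CH_norm_inflation (c : LPCutoff) :
    ∃ N : ℕ, ∀ n : ℕ, 16 ∣ n → N ≤ n →
      besov1E c (toC (u0CH c n)) ≤ ENNReal.ofReal (1 / Real.log (Real.log n)) ∧
      ∀ u : ℝ → ℝ → ℝ, IsCHSolution (1 / Real.log n) u → (∀ x, u 0 x = u0CH c n x) →
        ∃ t₀ ∈ Set.Ioc (0:ℝ) (1 / Real.log n),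
          ENNReal.ofReal (Real.log (Real.log n)) ≤ besov1E c (toC (u t₀)) := by
  exact CH_norm_inflation_proof c
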